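/- arXiv:2205.15054 — 2 statements merged into one kernel-verified Lean document; each statement's English description precedes it below -/
import Mathlib

section
/- There exists a universal constant C > 0 such that for every τ > 0, every β ≥ 1 and every n ≥ 1: P_n^β({(x_1,…,x_n) : max_{1≤j≤n} ∫_ℝ |ℓ_j(x)|^β dx > n^{1+τ}}) < C·(n^{−τ} + e^{−nβ/C}). -/
open MeasureTheory Filter Topology
open scoped ENNReal

/-- The (unnormalized) density of the Gaussian beta-ensemble with potential `x^2/2`. -/
noncomputable def gaussianDensity (n : ℕ) (β : ℝ) (x : Fin n → ℝ) : ℝ :=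
  (∏ p ∈ Finset.univ.filter (fun p : Fin n × Fin n => p.1 < p.2), |x p.1 - x p.2| ^ β) *
    Real.exp (-((n : ℝ) * β / 2) * ∑ j, (x j) ^ 2 / 2)

/-- The weighted Lagrange polynomial associated to the node `x j`. -/
noncomputable def lagrange (n : ℕ) (x : Fin n → ℝ) (j : Fin n) (t : ℝ) : ℝ :=
  (∏ k ∈ Finset.univ.erase j, (t - x k) / (x j - x k)) *
    Real.exp (-(n : ℝ) * (t ^ 2 - (x j) ^ 2) / 4)

/-- The pairs `p.1 < p.2` that involve the index `j` are parametrized by the other index. -/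
lemma prod_pairs_involving {n : ℕ} (f : Fin n × Fin n → ℝ)
    (hf : ∀ a b, f (a, b) = f (b, a)) (j : Fin n) :
    ∏ p ∈ (Finset.univ.filter (fun p : Fin n × Fin n => p.1 < p.2)).filter
      (fun p => p.1 = j ∨ p.2 = j), f p = ∏ k ∈ Finset.univ.erase j, f (j, k) := by
  refine Finset.prod_bij' (fun p _ => if p.1 = j then p.2 else p.1)
    (fun k _ => if k < j then (k, j) else (j, k)) ?_ ?_ ?_ ?_ ?_
  · rintro ⟨a, b⟩ h
    simp at h ⊢
    grind
  · intro k h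
    simp at h ⊢
    grind
  · rintro ⟨a, b⟩ h
    simp at h ⊢
    grind
  · intro k h
    simp at h ⊢
    grind
  · rintro ⟨a, b⟩ h
    simp at h ⊢
    grind

/-- The factor of the density that depends on the position `t` of the `j`-th particle. -/
noncomputable def particleWeight (n : ℕ) (β : ℝ) (x : Fin n → ℝ) (j : Fin n) (t : ℝ) : ℝ :=
  (∏ k ∈ Finset.univ.erase j, |t - x k| ^ β) * Real.exp (-((n : ℝ) * β) * t ^ 2 / 4)

lemma particleWeight_nonneg (n : ℕ) (β : ℝ) (x : Fin n → ℝ) (j : Fin n) (t : ℝ) :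
    0 ≤ particleWeight n β x j t := by
  unfold particleWeight
  positivity

lemma exists_gaussianDensity_update_eq (n : ℕ) (β : ℝ) (x : Fin n → ℝ) (j : Fin n) :
    ∃ A : ℝ, 0 ≤ A ∧
      ∀ t, gaussianDensity n β (Function.update x j t) = A * particleWeight n β x j t := by
  refine ⟨(∏ p ∈ (Finset.univ.filter (fun p : Fin n × Fin n => p.1 < p.2)).filter
      (fun p => ¬ (p.1 = j ∨ p.2 = j)), |x p.1 - x p.2| ^ β) *
      Real.exp (-((n : ℝ) * β / 2) * ∑ k ∈ Finset.univ.erase j, (x k) ^ 2 / 2),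
      by positivity, fun t => ?_⟩
  unfold gaussianDensity particleWeight
  rw [← Finset.prod_filter_mul_prod_filter_not _ (fun p : Fin n × Fin n => p.1 = j ∨ p.2 = j),
    prod_pairs_involving
      (fun p => |Function.update x j t p.1 - Function.update x j t p.2| ^ β)
      (fun a b => by simp only [abs_sub_comm]) j,
    ← Finset.add_sum_erase Finset.univ _ (Finset.mem_univ j)]
  have h1 : ∀ k ∈ Finset.univ.erase j,
      |Function.update x j t (j, k).1 - Function.update x j t (j, k).2| ^ β = |t - x k| ^ β := by
    intro k hk
    simp [Function.update_of_ne (Finset.ne_of_mem_erase hk)]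
  have h2 : ∀ p ∈ (Finset.univ.filter (fun p : Fin n × Fin n => p.1 < p.2)).filter
      (fun p => ¬ (p.1 = j ∨ p.2 = j)),
      |Function.update x j t p.1 - Function.update x j t p.2| ^ β = |x p.1 - x p.2| ^ β := by
    intro p hp
    have hp' := (Finset.mem_filter.1 hp).2
    push Not at hp'
    rw [Function.update_of_ne hp'.1, Function.update_of_ne hp'.2]
  have h3 : ∀ k ∈ Finset.univ.erase j, (Function.update x j t k) ^ 2 / 2 = x k ^ 2 / 2 := by
    intro k hk
    rw [Function.update_of_ne (Finset.ne_of_mem_erase hk)]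
  rw [Finset.prod_congr rfl h1, Finset.prod_congr rfl h2, Finset.sum_congr rfl h3,
    Function.update_self, mul_add, Real.exp_add]
  ring_nf

lemma particleWeight_mul_lagrange_le (n : ℕ) {β : ℝ} (hβ : 1 ≤ β) (x : Fin n → ℝ) (j : Fin n)
    (t : ℝ) :
    particleWeight n β x j (x j) * |lagrange n x j t| ^ β ≤ particleWeight n β x j t := by
  have h0 : β ≠ 0 := by linarith
  unfold particleWeight lagrange
  rw [abs_mul, Real.abs_exp, Real.mul_rpow (abs_nonneg _) (Real.exp_nonneg _), ← Real.exp_mul,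
    Finset.abs_prod, ← Real.finsetProd_rpow _ _ (fun i _ => abs_nonneg _)]
  calc _ = (∏ k ∈ Finset.univ.erase j, |x j - x k| ^ β * |(t - x k) / (x j - x k)| ^ β) *
        (Real.exp (-((n : ℝ) * β) * x j ^ 2 / 4) *
          Real.exp (-(n : ℝ) * (t ^ 2 - x j ^ 2) / 4 * β)) := by
        rw [Finset.prod_mul_distrib]; ring
    _ ≤ _ := by
        rw [← Real.exp_add]
        have : -((n : ℝ) * β) * x j ^ 2 / 4 + -(n : ℝ) * (t ^ 2 - x j ^ 2) / 4 * β
          = -((n : ℝ) * β) * t ^ 2 / 4 := by ring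
        rw [this]
        gcongr with k hk
        rw [← Real.mul_rpow (abs_nonneg _) (abs_nonneg _), ← abs_mul]
        by_cases h : x j - x k = 0
        · simp only [h, zero_mul, abs_zero]
          rw [Real.zero_rpow h0]
          positivity
        · rw [mul_div_cancel₀ _ h]

lemma intervalIntegrable_log_sub (c a b : ℝ) :
    IntervalIntegrable (fun y => Real.log (y - c)) volume a b := by
  simpa using
    (intervalIntegral.intervalIntegrable_log' (a := a - c) (b := b - c)).comp_sub_right c

lemma integral_log_abs_sub_ge (a : ℝ) :
    2 * (Real.log (1 + |a|) - 4) ≤ ∫ y in (-1 : ℝ)..1, Real.log |y - a| := by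
  simp only [Real.log_abs]
  rcases le_total |a| 2 with h | h
  · rw [intervalIntegral.integral_comp_sub_right (fun y => Real.log y), integral_log]
    have key : ∀ u : ℝ, -1 ≤ u → -1 ≤ u * Real.log u := by
      intro u hu
      rcases le_total u 0 with h0 | h0
      · have : Real.log u ≤ 0 := by
          rw [← Real.log_abs]
          exact Real.log_nonpos (abs_nonneg _) (abs_le.2 ⟨hu, by linarith⟩)
        nlinarith
      · rcases h0.eq_or_lt with h0 | h0
        · simp [← h0]
        · have := Real.one_sub_inv_le_log_of_pos h0
          have h2 : u * (1 - u⁻¹) ≤ u * Real.log u := by gcongr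
          have h3 : u * (1 - u⁻¹) = u - 1 := by field_simp
          linarith
    have ha := abs_le.1 h
    have h1 := key (1 - a) (by linarith)
    have h2 := key (1 + a) (by linarith)
    have h3 : Real.log (-1 - a) = Real.log (1 + a) := by
      rw [← Real.log_neg_eq_log]; ring_nf
    have h4 : Real.log (1 + |a|) ≤ 2 := by
      have := Real.log_le_sub_one_of_pos (x := 1 + |a|) (by positivity)
      linarith
    rw [h3]
    linarith
  · have hl : ∀ y ∈ Set.Icc (-1 : ℝ) 1, Real.log (1 + |a|) - 4 ≤ Real.log (y - a) := by
      intro y hy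
      have hy' : |y| ≤ 1 := abs_le.2 hy
      have h1 : |a| - 1 ≤ |y - a| := by
        have := abs_sub_abs_le_abs_sub a y
        rw [abs_sub_comm] at this
        linarith
      have h2 : (1 + |a|) / 3 ≤ |y - a| := by linarith
      have h3 : Real.log ((1 + |a|) / 3) ≤ Real.log |y - a| :=
        Real.log_le_log (by positivity) h2
      rw [Real.log_div (by positivity) (by norm_num), Real.log_abs] at h3
      have := Real.log_le_sub_one_of_pos (x := 3) (by norm_num)
      linarith
    have := intervalIntegral.integral_mono_on (μ := volume) (a := -1) (b := 1)
      (f := fun _ => Real.log (1 + |a|) - 4)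
      (g := fun y => Real.log (y - a)) (by norm_num) (by simp)
      (intervalIntegrable_log_sub a (-1) 1) hl
    rw [intervalIntegral.integral_const] at this
    norm_num at this ⊢
    linarith

lemma intervalIntegral_prod_abs_sub_rpow_ge {ι : Type*} (s : Finset ι) (x : ι → ℝ) {β : ℝ}
    (hβ : 0 ≤ β) :
    2 * ∏ k ∈ s, ((1 + |x k|) ^ β * Real.exp (-(4 * β))) ≤
      ∫ y in (-1 : ℝ)..1, ∏ k ∈ s, |y - x k| ^ β := by
  have hprod : ∏ k ∈ s, ((1 + |x k|) ^ β * Real.exp (-(4 * β))) =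
      Real.exp (∑ k ∈ s, β * (Real.log (1 + |x k|) - 4)) := by
    rw [Real.exp_sum]
    refine Finset.prod_congr rfl fun k _ => ?_
    rw [Real.rpow_def_of_pos (by positivity), ← Real.exp_add]
    ring_nf
  rw [hprod]
  set m := ∑ k ∈ s, β * (Real.log (1 + |x k|) - 4) with hm
  have hint : ∀ k ∈ s, IntervalIntegrable (fun y => β * Real.log |y - x k|) volume (-1) 1 := by
    intro k _
    simp only [Real.log_abs]
    exact (intervalIntegrable_log_sub (x k) (-1) 1).const_mul β
  have hsum : IntervalIntegrable (fun y => ∑ k ∈ s, β * Real.log |y - x k|) volume (-1) 1 := by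
    have h := IntervalIntegrable.sum s hint
    rwa [show (∑ k ∈ s, fun y => β * Real.log |y - x k|) =
      fun y => ∑ k ∈ s, β * Real.log |y - x k| from Finset.sum_fn s _] at h
  have h2m : 2 * m ≤ ∫ y in (-1 : ℝ)..1, ∑ k ∈ s, β * Real.log |y - x k| := by
    rw [intervalIntegral.integral_finsetSum hint, hm, Finset.mul_sum]
    refine Finset.sum_le_sum fun k _ => ?_
    rw [intervalIntegral.integral_const_mul]
    have := mul_le_mul_of_nonneg_left (integral_log_abs_sub_ge (x k)) hβ
    linarith
  have hae : ∀ᵐ y : ℝ, Real.exp m * ((∑ k ∈ s, β * Real.log |y - x k|) + (1 - m)) ≤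
      ∏ k ∈ s, |y - x k| ^ β := by
    have hne : ∀ᵐ y : ℝ, ∀ k ∈ s, y ≠ x k :=
      (ae_ball_iff s.countable_toSet).2 fun k _ => Measure.ae_ne volume (x k)
    filter_upwards [hne] with y hy
    have : ∏ k ∈ s, |y - x k| ^ β = Real.exp (∑ k ∈ s, β * Real.log |y - x k|) := by
      rw [Real.exp_sum]
      refine Finset.prod_congr rfl fun k hk => ?_
      rw [Real.rpow_def_of_pos (abs_pos.2 (sub_ne_zero.2 (hy k hk))), mul_comm]
    rw [this]
    set f := ∑ k ∈ s, β * Real.log |y - x k|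
    have h1 := Real.add_one_le_exp (f - m)
    calc Real.exp m * (f + (1 - m)) ≤ Real.exp m * Real.exp (f - m) := by gcongr; linarith
      _ = Real.exp f := by rw [← Real.exp_add]; ring_nf
  have hcont : Continuous fun y => ∏ k ∈ s, |y - x k| ^ β :=
    continuous_finsetProd s fun k _ =>
      (continuous_abs.comp (continuous_id.sub continuous_const)).rpow_const fun _ => Or.inr hβ
  have hmono := intervalIntegral.integral_mono_ae (μ := volume) (a := -1) (b := 1) (by norm_num)
    ((hsum.add (intervalIntegrable_const (c := 1 - m))).const_mul (Real.exp m))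
    (hcont.intervalIntegrable _ _) hae
  rw [intervalIntegral.integral_const_mul,
    intervalIntegral.integral_add hsum intervalIntegrable_const,
    intervalIntegral.integral_const] at hmono
  refine le_trans ?_ hmono
  rw [mul_comm]
  gcongr
  rw [smul_eq_mul]
  linarith

lemma continuous_particleWeight (n : ℕ) {β : ℝ} (hβ : 0 ≤ β) (x : Fin n → ℝ) (j : Fin n) :
    Continuous (particleWeight n β x j) := by
  unfold particleWeight
  refine (continuous_finsetProd _ fun k _ => ?_).mul (by fun_prop)
  exact (continuous_abs.comp (continuous_id.sub continuous_const)).rpow_const fun _ => Or.inr hβ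

lemma two_mul_particleWeight_le {n : ℕ} {β : ℝ} (hβ : 0 ≤ β) (x : Fin n → ℝ) (j : Fin n)
    {t : ℝ} (ht : 20 ≤ |t|) :
    2 * particleWeight n β x j t ≤ Real.exp (-((n : ℝ) * β) * (1 + t ^ 2 / 8)) *
      ∫ s in (-1 : ℝ)..1, particleWeight n β x j s := by
  have hnβ : 0 ≤ (n : ℝ) * β := by positivity
  have hcont : Continuous fun y => ∏ k ∈ Finset.univ.erase j, |y - x k| ^ β :=
    continuous_finsetProd _ fun k _ =>
      (continuous_abs.comp (continuous_id.sub continuous_const)).rpow_const fun _ => Or.inr hβ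
  have hlow : (2 * ∏ k ∈ Finset.univ.erase j, ((1 + |x k|) ^ β * Real.exp (-(4 * β)))) *
      Real.exp (-((n : ℝ) * β) / 4) ≤ ∫ s in (-1 : ℝ)..1, particleWeight n β x j s := by
    refine (mul_le_mul_of_nonneg_right (intervalIntegral_prod_abs_sub_rpow_ge
      (Finset.univ.erase j) x hβ) (Real.exp_nonneg _)).trans ?_
    rw [← intervalIntegral.integral_mul_const]
    refine intervalIntegral.integral_mono_on (by norm_num)
      ((hcont.mul continuous_const).intervalIntegrable _ _)
      ((continuous_particleWeight n hβ x j).intervalIntegrable _ _) fun s hs => ?_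
    unfold particleWeight
    have : s ^ 2 ≤ 1 := by nlinarith [hs.1, hs.2]
    gcongr ?_ * Real.exp ?_
    nlinarith
  have hup : ∏ k ∈ Finset.univ.erase j, |t - x k| ^ β ≤
      (∏ k ∈ Finset.univ.erase j, ((1 + |x k|) ^ β * Real.exp (-(4 * β)))) *
        Real.exp (n * β * (|t| + 4)) := by
    have h1 : ∀ k, |t - x k| ^ β ≤
        ((1 + |x k|) ^ β * Real.exp (-(4 * β))) * Real.exp (β * (|t| + 4)) := by
      intro k
      have h2 : |t - x k| ≤ (1 + |x k|) * Real.exp |t| := by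
        have := abs_sub t (x k)
        have := Real.add_one_le_exp |t|
        nlinarith [abs_nonneg t, abs_nonneg (x k)]
      calc |t - x k| ^ β ≤ ((1 + |x k|) * Real.exp |t|) ^ β := by gcongr
        _ = (1 + |x k|) ^ β * Real.exp (-(4 * β) + β * (|t| + 4)) := by
          rw [Real.mul_rpow (by positivity) (by positivity), ← Real.exp_mul]
          ring_nf
        _ = _ := by rw [Real.exp_add]; ring
    calc _ ≤ ∏ k ∈ Finset.univ.erase j,
          (((1 + |x k|) ^ β * Real.exp (-(4 * β))) * Real.exp (β * (|t| + 4))) := by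
          gcongr with k _; exact h1 k
      _ ≤ _ := by
          rw [Finset.prod_mul_distrib, Finset.prod_const, ← Real.exp_nat_mul]
          gcongr ?_ * Real.exp ?_
          rw [mul_assoc]
          gcongr
          simp
  set P := ∏ k ∈ Finset.univ.erase j, ((1 + |x k|) ^ β * Real.exp (-(4 * β))) with hP
  have hP0 : 0 ≤ P := by positivity
  calc 2 * particleWeight n β x j t
      ≤ 2 * ((P * Real.exp (n * β * (|t| + 4))) * Real.exp (-((n : ℝ) * β) * t ^ 2 / 4)) := by
        unfold particleWeight; gcongr
    _ = 2 * P * Real.exp (n * β * (|t| + 4 - t ^ 2 / 4)) := by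
        rw [mul_assoc P, ← Real.exp_add]; ring_nf
    _ ≤ 2 * P * Real.exp (-((n : ℝ) * β) * (1 + t ^ 2 / 8) + -((n : ℝ) * β) / 4) := by
        gcongr ?_ * Real.exp ?_
        rw [← sq_abs t]
        have : |t| + 4 - |t| ^ 2 / 4 ≤ -(1 + |t| ^ 2 / 8) - 1 / 4 := by nlinarith
        nlinarith [mul_le_mul_of_nonneg_left this hnβ]
    _ = Real.exp (-((n : ℝ) * β) * (1 + t ^ 2 / 8)) *
        ((2 * P) * Real.exp (-((n : ℝ) * β) / 4)) := by rw [Real.exp_add]; ring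
    _ ≤ _ := by gcongr

lemma gaussianDensity_nonneg (n : ℕ) (β : ℝ) (x : Fin n → ℝ) : 0 ≤ gaussianDensity n β x := by
  unfold gaussianDensity
  positivity

lemma measurable_gaussianDensity (n : ℕ) (β : ℝ) : Measurable (gaussianDensity n β) := by
  unfold gaussianDensity
  fun_prop

lemma measurable_lagrange (n : ℕ) (j : Fin n) :
    Measurable fun p : (Fin n → ℝ) × ℝ => lagrange n p.1 j p.2 := by
  unfold lagrange
  fun_prop

lemma gaussianDensity_mul_lagrange_le (n : ℕ) {β : ℝ} (hβ : 1 ≤ β) (x : Fin n → ℝ) (j : Fin n)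
    (t : ℝ) :
    gaussianDensity n β x * |lagrange n x j t| ^ β ≤
      gaussianDensity n β (Function.update x j t) := by
  obtain ⟨A, hA, h⟩ := exists_gaussianDensity_update_eq n β x j
  have hx := h (x j)
  rw [Function.update_eq_self] at hx
  rw [hx, h t, mul_assoc]
  exact mul_le_mul_of_nonneg_left (particleWeight_mul_lagrange_le n hβ x j t) hA

lemma ofReal_gaussianDensity_le {n : ℕ} {β Z : ℝ} (hβ : 0 ≤ β) (hZ : 0 < Z)
    (x : Fin n → ℝ) (j : Fin n) (hx : 20 ≤ |x j|) :
    ENNReal.ofReal (gaussianDensity n β x / Z) ≤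
      ENNReal.ofReal (Real.exp (-((n : ℝ) * β) * (1 + x j ^ 2 / 8)) / 2) *
        ∫⁻ s in Set.Ioc (-1 : ℝ) 1,
          ENNReal.ofReal (gaussianDensity n β (Function.update x j s) / Z) := by
  obtain ⟨A, hA, h⟩ := exists_gaussianDensity_update_eq n β x j
  have hxj := h (x j)
  rw [Function.update_eq_self] at hxj
  simp only [h]
  rw [← ofReal_integral_eq_lintegral_ofReal, ← ENNReal.ofReal_mul (by positivity), hxj,
    ← intervalIntegral.integral_of_le (by norm_num), intervalIntegral.integral_div,
    intervalIntegral.integral_const_mul]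
  · refine ENNReal.ofReal_le_ofReal ?_
    have := mul_le_mul_of_nonneg_left (two_mul_particleWeight_le hβ x j hx)
      (show 0 ≤ A / Z / 2 by positivity)
    calc _ = A / Z / 2 * (2 * particleWeight n β x j (x j)) := by ring
      _ ≤ _ := this
      _ = _ := by ring
  · exact (((continuous_particleWeight n hβ x j).const_mul A).div_const Z).integrableOn_Ioc
  · exact Eventually.of_forall fun s =>
      div_nonneg (mul_nonneg hA (particleWeight_nonneg n β x j s)) hZ.le

lemma lintegral_mul_lintegral_update_le {n : ℕ} {G : (Fin n → ℝ) → ℝ≥0∞} (hG : Measurable G)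
    {w : ℝ → ℝ≥0∞} (hw : Measurable w) (j : Fin n) (S : Set ℝ) :
    ∫⁻ x : Fin n → ℝ, w (x j) * ∫⁻ t in S, G (Function.update x j t) ≤
      (∫⁻ s, w s) * ∫⁻ x, G x := by
  have hupd : Measurable fun p : (Fin n → ℝ) × ℝ => G (Function.update p.1 j p.2) :=
    hG.comp measurable_update'
  have hint : Measurable fun x : Fin n → ℝ => ∫⁻ t in S, G (Function.update x j t) :=
    hupd.lintegral_prod_right'
  rw [← lintegral_const_mul _ hG]
  refine lintegral_le_of_lmarginal_le (μ := fun _ => volume) {j} (by fun_prop) (by fun_prop) ?_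
  intro x
  simp only [lmarginal_singleton, Function.update_self, Function.update_idem]
  rw [lintegral_mul_const _ hw, lintegral_const_mul (f := fun t => G (Function.update x j t)) _
    (hG.comp (measurable_update x))]
  gcongr
  exact Measure.restrict_le_self

section Ensemble

variable {n : ℕ} {β Z : ℝ} {μ : Measure (Fin n → ℝ)}

lemma lintegral_ofReal_gaussianDensity
    (hμ : μ = volume.withDensity (fun x => ENNReal.ofReal (gaussianDensity n β x / Z)))
    [IsProbabilityMeasure μ] :
    ∫⁻ x : Fin n → ℝ, ENNReal.ofReal (gaussianDensity n β x / Z) = 1 := by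
  have h : μ Set.univ = 1 := measure_univ
  rwa [hμ, withDensity_apply _ MeasurableSet.univ, Measure.restrict_univ] at h

lemma measure_abs_gt_le (hβ : 1 ≤ β) (hn : 1 ≤ n) (hZ : 0 < Z)
    (hμ : μ = volume.withDensity (fun x => ENNReal.ofReal (gaussianDensity n β x / Z)))
    [IsProbabilityMeasure μ] (j : Fin n) :
    μ {x | 20 < |x j|} ≤ ENNReal.ofReal (3 * Real.exp (-((n : ℝ) * β))) := by
  have hG : Measurable fun x : Fin n → ℝ => ENNReal.ofReal (gaussianDensity n β x / Z) :=
    ((measurable_gaussianDensity n β).div_const Z).ennreal_ofReal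
  have hS : MeasurableSet {x : Fin n → ℝ | 20 < |x j|} :=
    measurableSet_lt measurable_const (by fun_prop)
  have hnβ : 1 ≤ (n : ℝ) * β := by
    have : (1 : ℝ) ≤ n := by exact_mod_cast hn
    nlinarith
  set w : ℝ → ℝ≥0∞ := fun s =>
    ENNReal.ofReal (Real.exp (-((n : ℝ) * β) * (1 + s ^ 2 / 8)) / 2) with hw
  have hwle : ∫⁻ s, w s ≤ ENNReal.ofReal (3 * Real.exp (-((n : ℝ) * β))) := by
    calc ∫⁻ s, w s ≤ ∫⁻ s : ℝ, ENNReal.ofReal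
          (Real.exp (-((n : ℝ) * β)) / 2 * Real.exp (-(1 / 8) * s ^ 2)) := by
          refine lintegral_mono fun s => ENNReal.ofReal_le_ofReal ?_
          rw [div_mul_eq_mul_div, ← Real.exp_add]
          gcongr
          nlinarith [sq_nonneg s]
      _ = ENNReal.ofReal (Real.exp (-((n : ℝ) * β)) / 2 * √(Real.pi / (1 / 8))) := by
          rw [← ofReal_integral_eq_lintegral_ofReal
            ((integrable_exp_neg_mul_sq (by norm_num)).const_mul _)
            (Eventually.of_forall fun s => by positivity), integral_const_mul, integral_gaussian]
      _ ≤ _ := by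
          refine ENNReal.ofReal_le_ofReal ?_
          have : √(Real.pi / (1 / 8)) ≤ 6 := by
            rw [Real.sqrt_le_left (by norm_num)]
            linarith [Real.pi_le_four]
          nlinarith [Real.exp_pos (-((n : ℝ) * β))]
  calc μ {x | 20 < |x j|}
      = ∫⁻ x in {x : Fin n → ℝ | 20 < |x j|}, ENNReal.ofReal (gaussianDensity n β x / Z) := by
        rw [hμ, withDensity_apply _ hS]
    _ ≤ ∫⁻ x in {x : Fin n → ℝ | 20 < |x j|}, w (x j) * ∫⁻ s in Set.Ioc (-1 : ℝ) 1,
          ENNReal.ofReal (gaussianDensity n β (Function.update x j s) / Z) :=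
        setLIntegral_mono' hS fun x hx =>
          ofReal_gaussianDensity_le (by linarith) hZ x j (le_of_lt hx)
    _ ≤ ∫⁻ x : Fin n → ℝ, w (x j) * ∫⁻ s in Set.Ioc (-1 : ℝ) 1,
          ENNReal.ofReal (gaussianDensity n β (Function.update x j s) / Z) :=
        setLIntegral_le_lintegral _ _
    _ ≤ (∫⁻ s, w s) * ∫⁻ x : Fin n → ℝ, ENNReal.ofReal (gaussianDensity n β x / Z) :=
        lintegral_mul_lintegral_update_le hG (by fun_prop) j _
    _ ≤ _ := by rwa [lintegral_ofReal_gaussianDensity hμ, mul_one]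

lemma measure_lagrange_norm_gt_le (hβ : 1 ≤ β) (hZ : 0 < Z)
    (hμ : μ = volume.withDensity (fun x => ENNReal.ofReal (gaussianDensity n β x / Z)))
    [IsProbabilityMeasure μ] (j : Fin n) {c : ℝ} (hc : 0 < c) :
    μ ({x | ENNReal.ofReal c < ∫⁻ t : ℝ, ENNReal.ofReal (|lagrange n x j t| ^ β)} ∩
      {x | |x j| ≤ 20}) ≤ ENNReal.ofReal (40 / c) := by
  have hG : Measurable fun x : Fin n → ℝ => ENNReal.ofReal (gaussianDensity n β x / Z) :=
    ((measurable_gaussianDensity n β).div_const Z).ennreal_ofReal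
  have hS : MeasurableSet {x : Fin n → ℝ | |x j| ≤ 20} :=
    measurableSet_le (by fun_prop) measurable_const
  have hL := measurable_lagrange n j
  have hlag : Measurable fun p : (Fin n → ℝ) × ℝ =>
      ENNReal.ofReal (|lagrange n p.1 j p.2| ^ β) := by fun_prop
  have hF : Measurable fun x : Fin n → ℝ =>
      ∫⁻ t : ℝ, ENNReal.ofReal (|lagrange n x j t| ^ β) := hlag.lintegral_prod_right'
  set w : ℝ → ℝ≥0∞ := (Set.Icc (-20 : ℝ) 20).indicator 1 with hw
  have hmom : ∫⁻ x in {x : Fin n → ℝ | |x j| ≤ 20},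
      (∫⁻ t : ℝ, ENNReal.ofReal (|lagrange n x j t| ^ β)) ∂μ ≤ ENNReal.ofReal 40 := by
    rw [hμ, setLIntegral_withDensity_eq_setLIntegral_mul _ hG hF hS]
    calc _ ≤ ∫⁻ x in {x : Fin n → ℝ | |x j| ≤ 20}, w (x j) * ∫⁻ t in Set.univ,
          ENNReal.ofReal (gaussianDensity n β (Function.update x j t) / Z) := by
          refine setLIntegral_mono' hS fun x hx => ?_
          have hxj : |x j| ≤ 20 := hx
          have hwx : w (x j) = 1 := by
            rw [hw, Set.indicator_of_mem (Set.mem_Icc.2 (abs_le.1 hxj)), Pi.one_apply]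
          rw [hwx, one_mul, Measure.restrict_univ, Pi.mul_apply,
            ← lintegral_const_mul' _ _ ENNReal.ofReal_ne_top]
          refine lintegral_mono fun t => ?_
          rw [← ENNReal.ofReal_mul (div_nonneg (gaussianDensity_nonneg n β x) hZ.le),
            div_mul_eq_mul_div]
          gcongr
          exact gaussianDensity_mul_lagrange_le n hβ x j t
      _ ≤ ∫⁻ x : Fin n → ℝ, w (x j) * ∫⁻ t in Set.univ,
          ENNReal.ofReal (gaussianDensity n β (Function.update x j t) / Z) :=
          setLIntegral_le_lintegral _ _
      _ ≤ (∫⁻ s, w s) * ∫⁻ x : Fin n → ℝ, ENNReal.ofReal (gaussianDensity n β x / Z) :=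
          lintegral_mul_lintegral_update_le hG
            (measurable_one.indicator measurableSet_Icc) j _
      _ = ENNReal.ofReal 40 := by
          rw [lintegral_ofReal_gaussianDensity hμ, mul_one, hw,
            lintegral_indicator_one measurableSet_Icc, Real.volume_Icc]
          norm_num
  rw [← Measure.restrict_apply' hS]
  calc μ.restrict {x | |x j| ≤ 20}
        {x | ENNReal.ofReal c < ∫⁻ t : ℝ, ENNReal.ofReal (|lagrange n x j t| ^ β)}
      ≤ μ.restrict {x | |x j| ≤ 20}
        {x | ENNReal.ofReal c ≤ ∫⁻ t : ℝ, ENNReal.ofReal (|lagrange n x j t| ^ β)} :=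
        measure_mono (Set.ofPred_subset_ofPred.2 fun x hx => hx.le)
    _ ≤ _ := meas_ge_le_lintegral_div hF.aemeasurable (by simpa using hc) ENNReal.ofReal_ne_top
    _ ≤ ENNReal.ofReal 40 / ENNReal.ofReal c := by gcongr
    _ = _ := (ENNReal.ofReal_div_of_pos hc).symm

end Ensemble

/-- Probabilistic bound on the beta-norm of the Lagrange polynomials. -/
theorem lagrange_norm_bound :
    ∃ C : ℝ, 0 < C ∧
      ∀ τ : ℝ, 0 < τ → ∀ β : ℝ, 1 ≤ β → ∀ n : ℕ, 1 ≤ n →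
        ∀ Z : ℝ, 0 < Z →
        ∀ μ : Measure (Fin n → ℝ),
          μ = volume.withDensity (fun x => ENNReal.ofReal (gaussianDensity n β x / Z)) →
          IsProbabilityMeasure μ →
          μ {x | ∃ j : Fin n,
              ENNReal.ofReal ((n : ℝ) ^ (1 + τ)) <
                ∫⁻ t : ℝ, ENNReal.ofReal (|lagrange n x j t| ^ β)} <
            ENNReal.ofReal (C * ((n : ℝ) ^ (-τ) + Real.exp (-((n : ℝ) * β) / C))) := by
  refine ⟨100, by norm_num, fun τ _ β hβ n hn Z hZ μ hμ hprob => ?_⟩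
  have hn1 : (1 : ℝ) ≤ n := by exact_mod_cast hn
  have hn0 : (0 : ℝ) < n := by linarith
  have hc : 0 < (n : ℝ) ^ (1 + τ) := by positivity
  have hbad : μ {x | ∃ j : Fin n, ENNReal.ofReal ((n : ℝ) ^ (1 + τ)) <
      ∫⁻ t : ℝ, ENNReal.ofReal (|lagrange n x j t| ^ β)} ≤
      ENNReal.ofReal (n * (40 / (n : ℝ) ^ (1 + τ) + 3 * Real.exp (-((n : ℝ) * β)))) := by
    rw [Set.ofPred_exists]
    calc _ ≤ ∑ j : Fin n, μ {x | ENNReal.ofReal ((n : ℝ) ^ (1 + τ)) <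
          ∫⁻ t : ℝ, ENNReal.ofReal (|lagrange n x j t| ^ β)} := measure_iUnion_fintype_le _ _
      _ ≤ ∑ _j : Fin n,
          ENNReal.ofReal (40 / (n : ℝ) ^ (1 + τ) + 3 * Real.exp (-((n : ℝ) * β))) := by
          refine Finset.sum_le_sum fun j _ => ?_
          rw [ENNReal.ofReal_add (by positivity) (by positivity)]
          refine le_trans ?_ (add_le_add (measure_lagrange_norm_gt_le hβ hZ hμ j hc)
            (measure_abs_gt_le hβ hn hZ hμ j))
          refine le_trans (measure_mono fun x hx => ?_) (measure_union_le _ _)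
          exact (le_or_gt |x j| 20).imp (fun h => ⟨hx, h⟩) id
      _ = _ := by
          rw [Finset.sum_const, Finset.card_univ, Fintype.card_fin, nsmul_eq_mul,
            ENNReal.ofReal_mul hn0.le, ENNReal.ofReal_natCast]
  have hpow : n * (40 / (n : ℝ) ^ (1 + τ)) = 40 * (n : ℝ) ^ (-τ) := by
    rw [Real.rpow_add hn0, Real.rpow_one, Real.rpow_neg hn0.le]
    field_simp
  have hexp : n * Real.exp (-((n : ℝ) * β)) ≤ 2 * Real.exp (-((n : ℝ) * β) / 100) := by
    have h1 : (n : ℝ) ≤ 2 * Real.exp (n * β / 2) := by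
      have := Real.add_one_le_exp (n * β / 2)
      nlinarith
    calc n * Real.exp (-((n : ℝ) * β))
        ≤ 2 * Real.exp (n * β / 2) * Real.exp (-((n : ℝ) * β)) := by gcongr
      _ = 2 * Real.exp (n * β / 2 + -((n : ℝ) * β)) := by rw [Real.exp_add]; ring
      _ ≤ _ := by
        gcongr
        nlinarith
  refine hbad.trans_lt ((ENNReal.ofReal_lt_ofReal_iff (by positivity)).2 ?_)
  have hpos := Real.rpow_pos_of_pos hn0 (-τ)
  have hpos' := Real.exp_pos (-((n : ℝ) * β) / 100)
  rw [mul_add, hpow]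
  linarith
end

section
/- For every M ≥ 1 there is a constant C > 0 such that for every n ≥ 1 and every y ∈ ℝ with |y| ≤ 2 + M n^{−2/3}: ∫_{−2}^{2} K_n(x,y)^6 · K_n(x,x) dx ≤ C · K_n(y,y)^6. -/
open MeasureTheory Filter Topology
open scoped ENNReal

/-- Rescaled Hermite function `p_k`. -/
noncomputable def hermiteFun (n k : ℕ) (x : ℝ) : ℝ :=
  (n : ℝ) ^ ((1 : ℝ) / 4) * (2 * Real.pi) ^ (-(1 : ℝ) / 4) *
    ((Nat.factorial k : ℝ)) ^ (-(1 : ℝ) / 2) *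
    Polynomial.aeval (Real.sqrt n * x) (Polynomial.hermite k) *
    Real.exp (-(n : ℝ) * x ^ 2 / 4)

/-- The reproducing kernel of the space of weighted polynomials. -/
noncomputable def Kker (n : ℕ) (x y : ℝ) : ℝ :=
  ∑ k ∈ Finset.range n, hermiteFun n k x * hermiteFun n k y

open Polynomial in
theorem derivative_hermite_succ (n : ℕ) :
    derivative (hermite (n + 1)) = (n + 1 : ℤ[X]) * hermite n := by
  induction n with
  | zero => simp
  | succ n ih =>
    rw [hermite_succ (n + 1), derivative_sub, derivative_mul, ih, derivative_mul, hermite_succ n]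
    simp
    ring

/-- The value of the `k`-th probabilist Hermite polynomial at a real point. -/
noncomputable def hermiteVal (k : ℕ) (x : ℝ) : ℝ := Polynomial.aeval x (Polynomial.hermite k)

theorem hermiteVal_zero (x : ℝ) : hermiteVal 0 x = 1 := by simp [hermiteVal]

theorem hermiteVal_one (x : ℝ) : hermiteVal 1 x = x := by simp [hermiteVal]

theorem hermiteVal_add_two (k : ℕ) (x : ℝ) :
    hermiteVal (k + 2) x = x * hermiteVal (k + 1) x - (k + 1) * hermiteVal k x := by
  unfold hermiteVal
  rw [Polynomial.hermite_succ (k + 1), derivative_hermite_succ]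
  simp

theorem hasDerivAt_hermiteVal_succ (k : ℕ) (x : ℝ) :
    HasDerivAt (hermiteVal (k + 1)) ((k + 1) * hermiteVal k x) x := by
  have h := Polynomial.hasDerivAt_aeval (Polynomial.hermite (k + 1)) x
  rw [derivative_hermite_succ] at h
  refine h.congr_deriv ?_
  simp [hermiteVal]

theorem hasDerivAt_hermiteVal (k : ℕ) (x : ℝ) :
    HasDerivAt (hermiteVal k) (x * hermiteVal k x - hermiteVal (k + 1) x) x := by
  cases k with
  | zero =>
    have : hermiteVal 0 = fun _ => (1 : ℝ) := funext hermiteVal_zero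
    simpa [hermiteVal_one, this] using hasDerivAt_const x (1 : ℝ)
  | succ k =>
    convert hasDerivAt_hermiteVal_succ k x using 1
    rw [hermiteVal_add_two]; ring

/-- Christoffel–Darboux formula for the Hermite polynomials. -/
theorem hermiteVal_christoffelDarboux (m : ℕ) (x y : ℝ) :
    (x - y) * ∑ k ∈ Finset.range (m + 1), hermiteVal k x * hermiteVal k y / k.factorial =
      (hermiteVal (m + 1) x * hermiteVal m y - hermiteVal m x * hermiteVal (m + 1) y) /
        m.factorial := by
  induction m with
  | zero => simp [hermiteVal_zero, hermiteVal_one]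
  | succ m ih =>
    rw [Finset.sum_range_succ, mul_add, ih, hermiteVal_add_two, hermiteVal_add_two,
      Nat.factorial_succ]
    have : (m.factorial : ℝ) ≠ 0 := by positivity
    push_cast
    field_simp
    ring

/-- Confluent Christoffel–Darboux formula for the Hermite polynomials. -/
theorem hermiteVal_christoffelDarboux_diag (m : ℕ) (x : ℝ) :
    ∑ k ∈ Finset.range (m + 1), hermiteVal k x * hermiteVal k x / k.factorial =
      ((m + 1) * hermiteVal m x ^ 2 - x * hermiteVal m x * hermiteVal (m + 1) x +
        hermiteVal (m + 1) x ^ 2) / m.factorial := by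
  induction m with
  | zero => simp [hermiteVal_zero, hermiteVal_one]; ring
  | succ m ih =>
    rw [Finset.sum_range_succ, ih, hermiteVal_add_two, Nat.factorial_succ]
    have : (m.factorial : ℝ) ≠ 0 := by positivity
    push_cast
    field_simp
    ring

theorem hermiteVal_zero_bounds (m : ℕ) :
    hermiteVal (2 * m + 1) 0 = 0 ∧
    (hermiteVal (2 * m) 0 ^ 2 / (2 * m).factorial) ^ 2 * (2 * m + 1) ≤ 1 ∧
    1 ≤ (hermiteVal (2 * m) 0 ^ 2 / (2 * m).factorial) ^ 2 * (4 * m + 1) := by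
  induction m with
  | zero => simp [hermiteVal_zero, hermiteVal_one]
  | succ m ih =>
    obtain ⟨h1, h2, h3⟩ := ih
    have e : 2 * (m + 1) = 2 * m + 2 := by ring
    have hq : hermiteVal (2 * m + 2) 0 ^ 2 / (2 * m + 2).factorial =
        (2 * m + 1) / (2 * m + 2) * (hermiteVal (2 * m) 0 ^ 2 / (2 * m).factorial) := by
      rw [hermiteVal_add_two, Nat.factorial_succ, Nat.factorial_succ]
      have : ((2 * m).factorial : ℝ) ≠ 0 := by positivity
      push_cast
      field_simp
      ring
    rw [e, hq]
    generalize hermiteVal (2 * m) 0 ^ 2 / (2 * m).factorial = b at *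
    have hm : (0 : ℝ) ≤ m := by positivity
    refine ⟨?_, ?_, ?_⟩
    · rw [show 2 * m + 2 + 1 = (2 * m + 1) + 2 by ring, hermiteVal_add_two, h1]; simp
    · refine le_trans ?_ h2
      rw [mul_pow, div_pow, mul_comm _ (b ^ 2), mul_assoc]
      refine mul_le_mul_of_nonneg_left ?_ (sq_nonneg b)
      rw [div_mul_eq_mul_div, div_le_iff₀ (by positivity)]
      push_cast
      nlinarith
    · refine h3.trans ?_
      rw [mul_pow, div_pow, mul_comm _ (b ^ 2), mul_assoc]
      refine mul_le_mul_of_nonneg_left ?_ (sq_nonneg b)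
      rw [div_mul_eq_mul_div, le_div_iff₀ (by positivity)]
      push_cast
      nlinarith [mul_nonneg hm hm]

theorem hermiteVal_zero_sum_bounds (m : ℕ) :
    (hermiteVal (m + 1) 0 ^ 2 / (m + 1).factorial + hermiteVal m 0 ^ 2 / m.factorial) ^ 2
      * (m + 1) ∈ Set.Icc (1 / 3 : ℝ) 1 := by
  rcases Nat.even_or_odd' m with ⟨l, rfl | rfl⟩
  · obtain ⟨h1, h2, h3⟩ := hermiteVal_zero_bounds l
    rw [h1]
    generalize hermiteVal (2 * l) 0 ^ 2 / (2 * l).factorial = b at *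
    push_cast
    simp only [ne_eq, OfNat.ofNat_ne_zero, not_false_eq_true, zero_pow, zero_div, zero_add]
    have hm : (0 : ℝ) ≤ l := by positivity
    constructor <;> nlinarith [sq_nonneg b]
  · obtain ⟨h1, -, -⟩ := hermiteVal_zero_bounds l
    obtain ⟨-, h2, h3⟩ := hermiteVal_zero_bounds (l + 1)
    rw [h1, show 2 * l + 1 + 1 = 2 * (l + 1) by ring]
    generalize hermiteVal (2 * (l + 1)) 0 ^ 2 / (2 * (l + 1)).factorial = b at *
    push_cast at *
    simp only [ne_eq, OfNat.ofNat_ne_zero, not_false_eq_true, zero_pow, zero_div, add_zero]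
    have hm : (0 : ℝ) ≤ l := by positivity
    constructor <;> nlinarith [sq_nonneg b]

/-- A two-sided Grönwall inequality. -/
theorem le_mul_exp_of_abs_deriv_le {J J' m m' : ℝ → ℝ} {a b : ℝ} (hab : a ≤ b)
    (hJ : ∀ t ∈ Set.Icc a b, HasDerivAt J (J' t) t)
    (hm : ∀ t ∈ Set.Icc a b, HasDerivAt m (m' t) t)
    (h : ∀ t ∈ Set.Icc a b, |J' t| ≤ m' t * J t) :
    J b ≤ J a * Real.exp (m b - m a) ∧ J a ≤ J b * Real.exp (m b - m a) := by
  have key : ∀ σ : ℝ, ∀ t ∈ Set.Icc a b, HasDerivAt (fun t => J t * Real.exp (σ * m t))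
      ((J' t + σ * m' t * J t) * Real.exp (σ * m t)) t := by
    intro σ t ht
    refine ((hJ t ht).mul (((hm t ht).const_mul σ).exp)).congr_deriv ?_
    ring
  have hi : ∀ t ∈ interior (Set.Icc a b), t ∈ Set.Icc a b := fun t ht => interior_subset ht
  constructor
  · have := antitoneOn_of_deriv_nonpos (convex_Icc a b)
      (fun t ht => (key (-1) t ht).continuousAt.continuousWithinAt)
      (fun t ht => (key (-1) t (hi t ht)).differentiableAt.differentiableWithinAt)
      (fun t ht => by
        rw [(key (-1) t (hi t ht)).deriv]
        refine mul_nonpos_of_nonpos_of_nonneg ?_ (Real.exp_pos _).le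
        linarith [(abs_le.1 (h t (hi t ht))).2])
      (Set.left_mem_Icc.2 hab) (Set.right_mem_Icc.2 hab) hab
    simp only at this
    have h2 := mul_le_mul_of_nonneg_right this (Real.exp_pos (m b)).le
    rw [mul_assoc, mul_assoc, ← Real.exp_add, ← Real.exp_add] at h2
    simpa [neg_add_eq_sub] using h2
  · have := monotoneOn_of_deriv_nonneg (convex_Icc a b)
      (fun t ht => (key 1 t ht).continuousAt.continuousWithinAt)
      (fun t ht => (key 1 t (hi t ht)).differentiableAt.differentiableWithinAt)
      (fun t ht => by
        rw [(key 1 t (hi t ht)).deriv]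
        refine mul_nonneg ?_ (Real.exp_pos _).le
        linarith [(abs_le.1 (h t (hi t ht))).1])
      (Set.left_mem_Icc.2 hab) (Set.right_mem_Icc.2 hab) hab
    simp only at this
    have h2 := mul_le_mul_of_nonneg_right this (Real.exp_pos (-m a)).le
    rw [mul_assoc, mul_assoc, ← Real.exp_add, ← Real.exp_add] at h2
    simpa [← sub_eq_add_neg] using h2

/-- `u` solves the rescaled Hermite equation with derivative `v` and normalised initial energy. -/
structure IsHermiteSolution (N : ℝ) (u v : ℝ → ℝ) : Prop where
  hasDerivAt_fst : ∀ x, HasDerivAt u (v x) x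
  hasDerivAt_snd : ∀ x, HasDerivAt v (-(N ^ 2 * (1 + 1 / (2 * N) - x ^ 2 / 4) * u x)) x
  init_lower : 1 / 6 ≤ u 0 ^ 2 + v 0 ^ 2 / N ^ 2
  init_upper : u 0 ^ 2 + v 0 ^ 2 / N ^ 2 ≤ 1

theorem IsHermiteSolution.reflect {N : ℝ} {u v : ℝ → ℝ} (H : IsHermiteSolution N u v) :
    IsHermiteSolution N (fun x => u (-x)) (fun x => -v (-x)) where
  hasDerivAt_fst x := by
    refine ((H.hasDerivAt_fst (-x)).comp x (hasDerivAt_neg x)).congr_deriv ?_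
    simp
  hasDerivAt_snd x := by
    refine ((H.hasDerivAt_snd (-x)).comp x (hasDerivAt_neg x)).neg.congr_deriv ?_
    simp
  init_lower := by simpa using H.init_lower
  init_upper := by simpa using H.init_upper

/-- In the oscillatory region the Liouville–Green energy stays bounded above and below. -/
theorem IsHermiteSolution.liouvilleGreen {N h : ℝ} {u v : ℝ → ℝ} (H : IsHermiteSolution N u v)
    (hh : 0 < h) (hN : h ^ 3 * N = 1) (h1 : h ≤ 1) {x : ℝ} (hx : 0 ≤ x) {r : ℝ} (hr : 0 < r)
    (hrx : r ^ 2 = 1 + 1 / (2 * N) - x ^ 2 / 4) (hhr : h ≤ r) :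
    1 / 60 ≤ r * u x ^ 2 + v x ^ 2 / (N ^ 2 * r) ∧
      r * u x ^ 2 + v x ^ 2 / (N ^ 2 * r) ≤ 40 := by
  have hN1 : 1 ≤ N := by
    have : h ^ 3 ≤ 1 := pow_le_one₀ hh.le h1
    by_contra! hc
    have h3 : 0 < h ^ 3 := by positivity
    nlinarith
  have hN0 : 0 < N := by linarith
  set φ : ℝ → ℝ := fun t => 1 + 1 / (2 * N) - t ^ 2 / 4 with hφ
  have hinv : 1 / (2 * N) ≤ 1 / 2 := by
    rw [div_le_div_iff₀ (by positivity) (by norm_num)]; linarith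
  have hinv0 : 0 < 1 / (2 * N) := by positivity
  set R : ℝ → ℝ := fun t => Real.sqrt (φ t) with hR
  have hφge : ∀ t ∈ Set.Icc 0 x, h ^ 2 ≤ φ t := by
    intro t ht
    have : t ^ 2 ≤ x ^ 2 := by have := ht.1; have := ht.2; gcongr
    have : h ^ 2 ≤ r ^ 2 := by gcongr
    simp only [hφ]; linarith
  have hφpos : ∀ t ∈ Set.Icc 0 x, 0 < φ t := fun t ht =>
    lt_of_lt_of_le (by positivity) (hφge t ht)
  have hRsq : ∀ t ∈ Set.Icc 0 x, R t ^ 2 = φ t := fun t ht => Real.sq_sqrt (hφpos t ht).le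
  have hRh : ∀ t ∈ Set.Icc 0 x, h ≤ R t := fun t ht => Real.le_sqrt_of_sq_le (hφge t ht)
  have hRpos : ∀ t ∈ Set.Icc 0 x, 0 < R t := fun t ht => hh.trans_le (hRh t ht)
  have hRd : ∀ t ∈ Set.Icc 0 x, HasDerivAt R (-t / (4 * R t)) t := by
    intro t ht
    have hd : HasDerivAt φ (-(t / 2)) t := by
      refine (((hasDerivAt_pow 2 t).div_const 4).const_sub (1 + 1 / (2 * N))).congr_deriv ?_
      push_cast; ring
    refine (hd.sqrt (hφpos t ht).ne').congr_deriv ?_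
    have := (hRpos t ht).ne'
    change -(t / 2) / (2 * R t) = _
    field_simp; norm_num
  set m : ℝ → ℝ := fun t => t / 2 / R t ^ 3 with hm
  set m' : ℝ → ℝ := fun t => 1 / 2 / R t ^ 3 + 3 / 8 * t ^ 2 / R t ^ 5 with hm'
  have hmd : ∀ t ∈ Set.Icc 0 x, HasDerivAt m (m' t) t := by
    intro t ht
    have := (hRpos t ht).ne'
    refine (((hasDerivAt_id t).div_const 2).div ((hRd t ht).pow 3)
      (pow_ne_zero 3 this)).congr_deriv ?_
    simp only [hm', id, Pi.pow_apply]
    push_cast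
    field_simp
    ring
  have hR3 : ∀ t ∈ Set.Icc 0 x, 1 ≤ R t ^ 3 * N := by
    intro t ht
    rw [← hN]
    have := hRh t ht
    gcongr
  have hm0 : ∀ t ∈ Set.Icc 0 x, 0 ≤ m t ∧ m t ≤ 5 / 4 * N := by
    intro t ht
    have hp := hRpos t ht
    refine ⟨div_nonneg (by linarith [ht.1]) (by positivity), ?_⟩
    have ht2 : t ≤ 5 / 2 := by
      have := (hφpos t ht).le
      simp only [hφ] at this
      nlinarith [ht.1]
    simp only [hm]
    rw [div_le_iff₀ (by positivity)]
    nlinarith [hR3 t ht]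
  set J0 : ℝ → ℝ := fun t => R t * u t ^ 2 + v t ^ 2 / (N ^ 2 * R t) with hJ0
  set J : ℝ → ℝ := fun t => J0 t - m t * (u t * v t) / (2 * N ^ 2) with hJ
  have huv : ∀ t ∈ Set.Icc 0 x, |u t * v t| ≤ N / 2 * J0 t := by
    intro t ht
    have hp := hRpos t ht
    have e : N / 2 * J0 t = ((N * R t) ^ 2 * u t ^ 2 + v t ^ 2) / (2 * (N * R t)) := by
      simp only [hJ0]; field_simp
    rw [e, le_div_iff₀ (by positivity), ← abs_of_pos (show 0 < 2 * (N * R t) by positivity),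
      ← abs_mul, abs_le]
    constructor
    · nlinarith [sq_nonneg (N * R t * u t + v t)]
    · nlinarith [sq_nonneg (N * R t * u t - v t)]
  have hJJ : ∀ t ∈ Set.Icc 0 x, |J t - J0 t| ≤ J0 t / 2 := by
    intro t ht
    have e : J t - J0 t = -(m t * (u t * v t) / (2 * N ^ 2)) := by simp only [hJ]; ring
    rw [e, abs_neg, abs_div, abs_mul, abs_of_nonneg (hm0 t ht).1,
      abs_of_pos (show 0 < 2 * N ^ 2 by positivity), div_le_iff₀ (by positivity)]
    calc m t * |u t * v t| ≤ (5 / 4 * N) * (N / 2 * J0 t) :=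
          mul_le_mul (hm0 t ht).2 (huv t ht) (abs_nonneg _) (by positivity)
      _ ≤ J0 t / 2 * (2 * N ^ 2) := by
          have : 0 ≤ N / 2 * J0 t := (abs_nonneg _).trans (huv t ht)
          nlinarith
  have hJd : ∀ t ∈ Set.Icc 0 x, HasDerivAt J (-(m' t * (u t * v t) / (2 * N ^ 2))) t := by
    intro t ht
    have hp := (hRpos t ht).ne'
    have hu := H.hasDerivAt_fst t
    have hv := H.hasDerivAt_snd t
    have d := (((hRd t ht).mul (hu.pow 2)).add ((hv.pow 2).div ((hRd t ht).const_mul (N ^ 2))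
      (mul_ne_zero (by positivity) hp))).sub
      (((hmd t ht).mul (hu.mul hv)).div_const (2 * N ^ 2))
    refine HasDerivAt.congr_deriv d ?_
    have hs := hRsq t ht
    change R t ^ 2 = 1 + 1 / (2 * N) - t ^ 2 / 4 at hs
    rw [← hs]
    simp only [hm', hm, Pi.mul_apply, Pi.pow_apply]
    push_cast
    field_simp
    ring
  have hG := le_mul_exp_of_abs_deriv_le (m := fun t => m t / (2 * N)) (m' := fun t => m' t / (2 * N))
    hx hJd (fun t ht => (hmd t ht).div_const _) (by
      intro t ht
      have hp := hRpos t ht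
      have hm'0 : 0 ≤ m' t := by simp only [hm']; positivity
      rw [abs_neg, abs_div, abs_mul, abs_of_nonneg hm'0,
        abs_of_pos (show 0 < 2 * N ^ 2 by positivity)]
      have h1 := huv t ht
      have h2 := (abs_le.1 (hJJ t ht)).1
      calc m' t * |u t * v t| / (2 * N ^ 2) ≤ m' t * (N / 2 * (2 * J t)) / (2 * N ^ 2) := by
            gcongr
            refine h1.trans ?_
            gcongr
            linarith
        _ = m' t / (2 * N) * J t := by field_simp)
  have h0 : (0 : ℝ) ∈ Set.Icc 0 x := ⟨le_rfl, hx⟩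
  have hxx : x ∈ Set.Icc 0 x := ⟨hx, le_rfl⟩
  have hm00 : m 0 = 0 := by simp [hm]
  have hJ00 : J 0 = J0 0 := by simp [hJ, hm00]
  have hRx : R x = r := by
    simp only [hR, hφ]; rw [← hrx]; exact Real.sqrt_sq hr.le
  have hexp : Real.exp (m x / (2 * N) - m 0 / (2 * N)) ≤ 3 := by
    have : m x / (2 * N) - m 0 / (2 * N) ≤ 1 := by
      rw [hm00, zero_div, sub_zero, div_le_iff₀ (by positivity)]
      linarith [(hm0 x hxx).2]
    exact (Real.exp_le_exp.2 this).trans (by linarith [Real.exp_one_lt_d9])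
  have hexp0 := Real.exp_pos (m x / (2 * N) - m 0 / (2 * N))
  have hR0 : 1 ≤ R 0 ∧ R 0 ≤ 2 := by
    constructor
    · apply Real.le_sqrt_of_sq_le; simp only [hφ]; linarith
    · rw [hR]; simp only [hφ]; rw [Real.sqrt_le_left (by norm_num)]; linarith
  have hi0 : 1 / 12 ≤ J0 0 ∧ J0 0 ≤ 3 := by
    have a1 := H.init_lower
    have a2 := H.init_upper
    have e : J0 0 = R 0 * u 0 ^ 2 + v 0 ^ 2 / N ^ 2 / R 0 := by simp only [hJ0]; field_simp
    rw [e]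
    have hq0 : 0 ≤ v 0 ^ 2 / N ^ 2 := by positivity
    have hu0 := sq_nonneg (u 0)
    have b1 : v 0 ^ 2 / N ^ 2 / R 0 ≤ v 0 ^ 2 / N ^ 2 := div_le_self hq0 hR0.1
    have b2 : v 0 ^ 2 / N ^ 2 / 2 ≤ v 0 ^ 2 / N ^ 2 / R 0 :=
      div_le_div_of_nonneg_left hq0 (by linarith) hR0.2
    constructor <;> nlinarith
  have hgoal : r * u x ^ 2 + v x ^ 2 / (N ^ 2 * r) = J0 x := by simp only [hJ0, hRx]
  rw [hgoal]
  have c1 := abs_le.1 (hJJ x hxx)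
  simp only [hJ00] at hG
  have hJx : 0 ≤ J x := by
    have : 0 ≤ J0 x := by have := hRpos x hxx; simp only [hJ0]; positivity
    linarith
  have d1 : J0 0 * Real.exp (m x / (2 * N) - m 0 / (2 * N)) ≤ J0 0 * 3 := by
    gcongr
  have d2 : J x * Real.exp (m x / (2 * N) - m 0 / (2 * N)) ≤ J x * 3 := by gcongr
  constructor <;> linarith

theorem Kker_eq_sum_hermiteVal (n : ℕ) (x y : ℝ) :
    Kker n x y = ((n : ℝ) ^ ((1 : ℝ) / 4) * (2 * Real.pi) ^ (-(1 : ℝ) / 4)) ^ 2 *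
      (Real.exp (-(n : ℝ) * x ^ 2 / 4) * Real.exp (-(n : ℝ) * y ^ 2 / 4)) *
      ∑ k ∈ Finset.range n, hermiteVal k (Real.sqrt n * x) * hermiteVal k (Real.sqrt n * y) /
        k.factorial := by
  unfold Kker
  rw [Finset.mul_sum]
  refine Finset.sum_congr rfl fun k _ => ?_
  have hf : ((k.factorial : ℝ) ^ (-(1 : ℝ) / 2)) ^ 2 = 1 / k.factorial := by
    rw [← Real.rpow_natCast, ← Real.rpow_mul (by positivity)]
    norm_num [Real.rpow_neg_one]
  unfold hermiteFun
  change _ * hermiteVal k _ * _ * (_ * hermiteVal k _ * _) = _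
  rw [div_eq_mul_one_div _ (k.factorial : ℝ), ← hf]
  ring

/-- The kernel is expressed through the `n`-th Hermite function and its derivative. -/
theorem exists_isHermiteSolution_Kker (n : ℕ) (hn : 1 ≤ n) :
    ∃ u v : ℝ → ℝ, IsHermiteSolution n u v ∧
      (∀ x, Kker n x x = v x ^ 2 / n + n * (1 - x ^ 2 / 4) * u x ^ 2) ∧
      ∀ x y, (x - y) * Kker n x y =
        (u x * v y - v x * u y) / n - (x - y) / 2 * (u x * u y) := by
  obtain ⟨m, rfl⟩ : ∃ m, n = m + 1 := ⟨n - 1, by omega⟩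
  have hm : (0 : ℝ) < ((m + 1 : ℕ) : ℝ) := by positivity
  set s : ℝ := Real.sqrt ((m + 1 : ℕ) : ℝ) with hs
  have hs2 : s ^ 2 = m + 1 := by rw [hs, Real.sq_sqrt hm.le]; push_cast; ring
  have hs0 : 0 < s := Real.sqrt_pos.2 hm
  have hms : (m : ℝ) = s ^ 2 - 1 := by rw [hs2]; ring
  have hf0 : (m.factorial : ℝ) ≠ 0 := by positivity
  set w : ℝ := ((m + 1 : ℕ) : ℝ) ^ ((1 : ℝ) / 4) * (2 * Real.pi) ^ (-(1 : ℝ) / 4) with hw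
  have hw4 : w ^ 4 = (m + 1) / (2 * Real.pi) := by
    rw [hw, mul_pow, ← Real.rpow_natCast, ← Real.rpow_natCast, ← Real.rpow_mul hm.le,
      ← Real.rpow_mul (by positivity)]
    norm_num [Real.rpow_neg_one]
    ring
  set g : ℝ := w / Real.sqrt (m + 1).factorial with hg
  have hg2 : g ^ 2 = w ^ 2 / ((m + 1) * m.factorial) := by
    rw [hg, div_pow, Real.sq_sqrt (by positivity), Nat.factorial_succ]; push_cast; ring
  set e : ℝ → ℝ := fun x => Real.exp (-((m + 1 : ℕ) : ℝ) * x ^ 2 / 4) with he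
  have hed : ∀ x, HasDerivAt e (-((m + 1) * x / 2) * e x) x := by
    intro x
    refine ((((hasDerivAt_pow 2 x).const_mul (-((m + 1 : ℕ) : ℝ))).div_const 4).exp).congr_deriv ?_
    simp only [he]
    push_cast
    ring
  have hlin : ∀ x : ℝ, HasDerivAt (fun x => s * x) s x := fun x => by
    simpa using (hasDerivAt_id x).const_mul s
  have hA : ∀ x, HasDerivAt (fun x => hermiteVal (m + 1) (s * x))
      ((m + 1) * hermiteVal m (s * x) * s) x := fun x =>
    (hasDerivAt_hermiteVal_succ m (s * x)).comp x (hlin x)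
  have hB : ∀ x, HasDerivAt (fun x => hermiteVal m (s * x))
      ((s * x * hermiteVal m (s * x) - hermiteVal (m + 1) (s * x)) * s) x := fun x =>
    (hasDerivAt_hermiteVal m (s * x)).comp x (hlin x)
  have hK : ∀ x y, Kker (m + 1) x y = w ^ 2 * (e x * e y) * ∑ k ∈ Finset.range (m + 1),
      hermiteVal k (s * x) * hermiteVal k (s * y) / k.factorial :=
    Kker_eq_sum_hermiteVal (m + 1)
  have hms' : (((m + 1 : ℕ) : ℝ)) = s ^ 2 := by rw [hs2]; push_cast; ring
  have hw2 : w ^ 2 = g ^ 2 * (s ^ 2 * m.factorial) := by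
    rw [hg2, hs2]; field_simp
  have e0 : e 0 = 1 := by simp [he]
  clear_value g w s e
  have hS := hermiteVal_zero_sum_bounds m
  set S : ℝ := hermiteVal (m + 1) 0 ^ 2 / (m + 1).factorial + hermiteVal m 0 ^ 2 / m.factorial
    with hSdef
  have hinit : (g * hermiteVal (m + 1) 0) ^ 2 +
      (g * ((m + 1) * hermiteVal m 0 * s)) ^ 2 / ((m + 1 : ℕ) : ℝ) ^ 2 = w ^ 2 * S := by
    rw [hSdef, mul_pow, mul_pow g, hg2, Nat.factorial_succ, mul_pow _ s, hs2]
    push_cast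
    field_simp
  refine ⟨fun x => g * (hermiteVal (m + 1) (s * x) * e x),
    fun x => g * (((m + 1) * hermiteVal m (s * x) * s -
      (m + 1) * x / 2 * hermiteVal (m + 1) (s * x)) * e x), ⟨?_, ?_, ?_, ?_⟩, ?_, ?_⟩
  · intro x
    refine (((hA x).mul (hed x)).const_mul g).congr_deriv ?_
    ring
  · intro x
    refine ((((((hB x).const_mul ((m : ℝ) + 1)).mul_const s).sub
      ((((hasDerivAt_id x).const_mul ((m : ℝ) + 1)).div_const 2).mul (hA x))).mul
      (hed x)).const_mul g |>.congr_deriv ?_)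
    simp only [id, Pi.sub_apply, Pi.mul_apply]
    push_cast
    rw [hms]
    have h1 : s ≠ 0 := hs0.ne'
    field_simp
    ring
  · have h1 := hS.1
    simp only [e0, mul_zero, mul_one, zero_mul, zero_div, sub_zero]
    rw [hinit]
    by_contra! hc
    have h2 : (w ^ 2 * S) ^ 2 < (1 / 6) ^ 2 := by gcongr
    have h3 : (w ^ 2 * S) ^ 2 = S ^ 2 * (m + 1) / (2 * Real.pi) := by
      rw [mul_pow, ← pow_mul, hw4]; ring
    rw [h3, div_lt_iff₀ (by positivity)] at h2
    linarith [Real.pi_lt_four]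
  · have h1 := hS.2
    simp only [e0, mul_zero, mul_one, zero_mul, zero_div, sub_zero]
    rw [hinit]
    by_contra! hc
    have h2 : (1 : ℝ) ^ 2 < (w ^ 2 * S) ^ 2 := by gcongr
    have h3 : (w ^ 2 * S) ^ 2 = S ^ 2 * (m + 1) / (2 * Real.pi) := by
      rw [mul_pow, ← pow_mul, hw4]; ring
    rw [h3, lt_div_iff₀ (by positivity)] at h2
    linarith [Real.pi_gt_three]
  · intro x
    have h1 : s ≠ 0 := hs0.ne'
    rw [hK x x, hermiteVal_christoffelDarboux_diag, hw2, hms', hms]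
    field_simp
    ring
  · intro x y
    have h1 : s ≠ 0 := hs0.ne'
    have hcd := hermiteVal_christoffelDarboux m (s * x) (s * y)
    rw [hK x y, hw2, hms', hms]
    calc _ = g ^ 2 * s * m.factorial * (e x * e y) *
          ((s * x - s * y) * ∑ k ∈ Finset.range (m + 1),
        hermiteVal k (s * x) * hermiteVal k (s * y) / k.factorial) := by ring
      _ = _ := by rw [hcd]; field_simp; ring

/-- Near the turning point the Hermite equation only changes the natural energy by a bounded
factor. -/
theorem IsHermiteSolution.exists_edge_energy_bounds (L : ℝ) (hL : 1 ≤ L) :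
    ∃ c C : ℝ, 0 < c ∧ 0 < C ∧ ∀ (N h : ℝ) (u v : ℝ → ℝ), IsHermiteSolution N u v → 0 < h →
      h ^ 3 * N = 1 → h ≤ 1 / 2 → ∀ x, 0 ≤ x → 1 + 1 / (2 * N) - x ^ 2 / 4 ≤ h ^ 2 →
      x ≤ 2 + L * h ^ 2 →
      c ≤ h * (u x ^ 2 + h ^ 4 * v x ^ 2) ∧ h * (u x ^ 2 + h ^ 4 * v x ^ 2) ≤ C := by
  set κ : ℝ := 1 + L + L ^ 2 with hκ
  set D : ℝ := Real.exp (κ * (L + 2)) with hD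
  refine ⟨1 / 60 / D, 40 * D, by positivity, by positivity, ?_⟩
  intro N h u v H hh hN h1 x hx0 hxφ hxL
  have hNe : N = 1 / h ^ 3 := by field_simp; linarith
  have hNi : 1 / (2 * N) = h ^ 3 / 2 := by rw [hNe]; field_simp
  rw [hNi] at hxφ
  have hh2 : h ^ 2 ≤ 1 / 4 := by nlinarith
  have hh3 : 0 < h ^ 3 := by positivity
  have hp : 0 ≤ 1 + h ^ 3 / 2 - h ^ 2 := by linarith
  set x1 : ℝ := 2 * Real.sqrt (1 + h ^ 3 / 2 - h ^ 2) with hx1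
  have hx1sq : x1 ^ 2 = 4 * (1 + h ^ 3 / 2 - h ^ 2) := by
    rw [hx1, mul_pow, Real.sq_sqrt hp]; norm_num
  have hx10 : 0 ≤ x1 := by positivity
  have hx1x : x1 ≤ x := by
    apply le_of_sq_le_sq _ hx0
    rw [hx1sq]; linarith
  have hx1l : 2 - 2 * h ^ 2 ≤ x1 := by
    apply le_of_sq_le_sq _ hx10
    rw [hx1sq]; nlinarith
  have hLG := H.liouvilleGreen hh hN (by linarith) hx10 hh (by rw [hNi, hx1sq]; ring) le_rfl
  have hstart : h * u x1 ^ 2 + v x1 ^ 2 / (N ^ 2 * h) = h * (u x1 ^ 2 + h ^ 4 * v x1 ^ 2) := by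
    rw [hNe]; field_simp
  rw [hstart] at hLG
  have hG := le_mul_exp_of_abs_deriv_le (J := fun t => h * (u t ^ 2 + h ^ 4 * v t ^ 2))
    (J' := fun t => h * (2 * (u t * v t) * (1 - (1 + h ^ 3 / 2 - t ^ 2 / 4) / h ^ 2)))
    (m := fun t => κ / h ^ 2 * t) (m' := fun _ => κ / h ^ 2) hx1x
    (by
      intro t _
      have hu := H.hasDerivAt_fst t
      have hv := H.hasDerivAt_snd t
      refine (((hu.pow 2).add ((hv.pow 2).const_mul (h ^ 4))).const_mul h).congr_deriv ?_
      rw [hNi, hNe]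
      push_cast
      field_simp
      ring)
    (by
      intro t _
      simpa using (hasDerivAt_id t).const_mul (κ / h ^ 2))
    (by
      intro t ht
      have ht2 : t ^ 2 ≤ (2 + L * h ^ 2) ^ 2 := by
        have := ht.1; have := ht.2
        gcongr <;> linarith
      have ht1 : x1 ^ 2 ≤ t ^ 2 := by have := ht.1; gcongr
      rw [hx1sq] at ht1
      have hb : |1 - (1 + h ^ 3 / 2 - t ^ 2 / 4) / h ^ 2| ≤ κ := by
        have e : 1 - (1 + h ^ 3 / 2 - t ^ 2 / 4) / h ^ 2 =
          (h ^ 2 - (1 + h ^ 3 / 2 - t ^ 2 / 4)) / h ^ 2 := by field_simp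
        rw [e, abs_of_nonneg (div_nonneg (by linarith) (by positivity)),
          div_le_iff₀ (by positivity)]
        have h4 : L ^ 2 * (h ^ 2 * h ^ 2) ≤ L ^ 2 * (h ^ 2 * 1) := by gcongr; linarith
        rw [hκ]
        nlinarith
      have huv : |2 * (u t * v t)| ≤ (u t ^ 2 + h ^ 4 * v t ^ 2) / h ^ 2 := by
        rw [le_div_iff₀ (by positivity), ← abs_of_pos (show 0 < h ^ 2 by positivity), ← abs_mul,
          abs_le]
        constructor
        · nlinarith [sq_nonneg (u t + h ^ 2 * v t)]
        · nlinarith [sq_nonneg (u t - h ^ 2 * v t)]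
      rw [abs_mul, abs_mul, abs_of_pos hh]
      calc h * (|2 * (u t * v t)| * |1 - (1 + h ^ 3 / 2 - t ^ 2 / 4) / h ^ 2|)
          ≤ h * ((u t ^ 2 + h ^ 4 * v t ^ 2) / h ^ 2 * κ) := by gcongr
        _ = _ := by ring)
  have hexp : Real.exp (κ / h ^ 2 * x - κ / h ^ 2 * x1) ≤ D := by
    rw [hD, Real.exp_le_exp]
    have : κ / h ^ 2 * x - κ / h ^ 2 * x1 = κ * ((x - x1) / h ^ 2) := by ring
    rw [this]
    gcongr
    rw [div_le_iff₀ (by positivity)]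
    linarith
  have hDp : 0 < D := Real.exp_pos _
  have hE : 0 ≤ h * (u x ^ 2 + h ^ 4 * v x ^ 2) := by positivity
  constructor
  · rw [div_le_iff₀ hDp]
    exact hLG.1.trans (hG.2.trans (by gcongr))
  · exact hG.1.trans (mul_le_mul hLG.2 hexp (Real.exp_pos _).le (by norm_num))

set_option maxHeartbeats 400000 in
/-- Near the turning point the diagonal expression is bounded below at its natural scale. -/
theorem IsHermiteSolution.exists_edge_diag_lower (L : ℝ) (hL : 1 ≤ L) :
    ∃ h₀ c : ℝ, 0 < h₀ ∧ 0 < c ∧ ∀ (N h : ℝ) (u v : ℝ → ℝ), IsHermiteSolution N u v →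
      (∀ x, 0 ≤ v x ^ 2 / N + N * (1 - x ^ 2 / 4) * u x ^ 2) → 0 < h →
      h ^ 3 * N = 1 → h ≤ h₀ → ∀ y, 0 ≤ y → 1 + 1 / (2 * N) - y ^ 2 / 4 ≤ h ^ 2 →
      y ≤ 2 + L * h ^ 2 → c / h ^ 2 ≤ v y ^ 2 / N + N * (1 - y ^ 2 / 4) * u y ^ 2 := by
  obtain ⟨c, C, hc, hC, hE⟩ := exists_edge_energy_bounds (L + 1) (by linarith)
  set B : ℝ := L + L ^ 2 with hB
  have hB0 : 0 < B := by positivity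
  set η : ℝ := 1 / (2 * (1 + B)) with hη
  have hη0 : 0 < η := by positivity
  set Q : ℝ := C / (c * η) + 1 with hQ
  have hQ1 : 1 ≤ Q := by rw [hQ]; linarith [show 0 < C / (c * η) by positivity]
  set s : ℝ := 1 / (2 * Real.sqrt Q) with hs
  have hsQ : 1 ≤ Real.sqrt Q := by rw [Real.one_le_sqrt]; exact hQ1
  have hs0 : 0 < s := by positivity
  have hs1 : s ≤ 1 := by
    rw [hs, div_le_one (by positivity)]; linarith
  clear_value B η Q s
  refine ⟨min (1 / 2) (s / 8), min (c / 2) (s * η * c / 16), by positivity, by positivity, ?_⟩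
  intro N h u v H hk hh hN hh0 y hy0 hyφ hyL
  have hh12 : h ≤ 1 / 2 := hh0.trans (min_le_left _ _)
  have hhs : h ≤ s / 8 := hh0.trans (min_le_right _ _)
  have hNe : N = 1 / h ^ 3 := by field_simp; linarith
  have hN0 : 0 < N := by rw [hNe]; positivity
  have hNi : 1 / (2 * N) = h ^ 3 / 2 := by rw [hNe]; field_simp
  have hE' := hE N h u v H hh hN hh12
  have hEy := hE' y hy0 hyφ (by nlinarith [sq_nonneg h])
  set E : ℝ := u y ^ 2 + h ^ 4 * v y ^ 2 with hEdef
  have hE0 : 0 < E := by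
    have : 0 < h * E := lt_of_lt_of_le hc hEy.1
    exact (pos_iff_pos_of_mul_pos this).1 hh
  have hφy : -(B * h ^ 2) ≤ 1 - y ^ 2 / 4 := by
    have ht2 : y ^ 2 ≤ (2 + L * h ^ 2) ^ 2 := by gcongr
    have h4 : L ^ 2 * (h ^ 2 * h ^ 2) ≤ L ^ 2 * (h ^ 2 * 1) := by gcongr; nlinarith
    rw [hB]
    nlinarith
  have hmin : ∀ a, min (c / 2) (s * η * c / 16) ≤ a →
      min (c / 2) (s * η * c / 16) / h ^ 2 ≤ a / h ^ 2 := fun a ha => by gcongr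
  rcases lt_or_ge (u y ^ 2) (η * E) with hcase | hcase
  · refine (hmin _ (min_le_left _ _)).trans ?_
    have e : v y ^ 2 / N + N * (1 - y ^ 2 / 4) * u y ^ 2 =
        (h * (h ^ 4 * v y ^ 2) + (1 - y ^ 2 / 4) / h ^ 2 * h * u y ^ 2) / h ^ 2 := by
      rw [hNe]; field_simp
    rw [e]
    gcongr
    have h5 : -B ≤ (1 - y ^ 2 / 4) / h ^ 2 := by
      rw [le_div_iff₀ (by positivity)]; linarith
    have h6 : -B * (h * u y ^ 2) ≤ (1 - y ^ 2 / 4) / h ^ 2 * (h * u y ^ 2) := by gcongr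
    have h7 : h * ((1 + B) * u y ^ 2) ≤ h * (E / 2) := by
      gcongr
      have : (1 + B) * (η * E) = E / 2 := by rw [hη]; field_simp
      rw [← this]
      gcongr
    have h8 : h * E = h * u y ^ 2 + h * (h ^ 4 * v y ^ 2) := by rw [hEdef]; ring
    linarith [hEy.1]
  · refine (hmin _ (min_le_right _ _)).trans ?_
    set z : ℝ := y + s * h ^ 2 with hz
    have hyz : y ≤ z := by rw [hz]; linarith [show 0 < s * h ^ 2 by positivity]
    have hsh : s * h ^ 2 ≤ h ^ 2 := by nlinarith [sq_nonneg h]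
    have hvt : ∀ t ∈ Set.Icc y z, |v t| ≤ Real.sqrt Q * |u y| / h ^ 2 := by
      intro t ht
      have hty : y ^ 2 ≤ t ^ 2 := by have := ht.1; gcongr
      have b := (hE' t (hy0.trans ht.1) (by linarith) (by rw [hz] at ht; linarith [ht.2])).2
      rw [le_div_iff₀ (by positivity)]
      apply abs_le_of_sq_le_sq' _ (by positivity) |>.2
      rw [mul_pow, mul_pow, Real.sq_sqrt (by linarith), sq_abs, sq_abs]
      have b1 : h * (h ^ 4 * v t ^ 2) ≤ C :=
        le_trans (by gcongr; exact le_add_of_nonneg_left (sq_nonneg _)) b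
      have b2 : C ≤ h * (Q * u y ^ 2) := by
        have : C / (c * η) * (η * c) ≤ Q * (η * (h * E)) := by
          gcongr
          · rw [hQ]; linarith
          · exact hEy.1
        have e : C / (c * η) * (η * c) = C := by field_simp
        rw [e] at this
        calc C ≤ Q * (η * (h * E)) := this
          _ = h * (Q * (η * E)) := by ring
          _ ≤ h * (Q * u y ^ 2) := by gcongr
      have b3 := le_of_mul_le_mul_left (b1.trans b2) hh
      rwa [← pow_mul, mul_comm]
    have hut : ∀ t ∈ Set.Icc y z, u y ^ 2 / 4 ≤ u t ^ 2 := by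
      intro t ht
      have hmv := (convex_Icc y z).norm_image_sub_le_of_norm_hasDerivWithin_le
        (fun t _ => (H.hasDerivAt_fst t).hasDerivWithinAt) hvt (Set.left_mem_Icc.2 hyz) ht
      rw [Real.norm_eq_abs, Real.norm_eq_abs] at hmv
      have hd : |t - y| ≤ s * h ^ 2 := by
        rw [abs_of_nonneg (by linarith [ht.1])]; rw [hz] at ht; linarith [ht.2]
      have hmv2 : |u t - u y| ≤ |u y| / 2 := by
        refine hmv.trans ?_
        calc Real.sqrt Q * |u y| / h ^ 2 * |t - y| ≤ Real.sqrt Q * |u y| / h ^ 2 * (s * h ^ 2) := by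
              gcongr
          _ = |u y| / 2 := by rw [hs]; field_simp
      have h3 : |u y| / 2 ≤ |u t| := by
        have := abs_sub_abs_le_abs_sub (u y) (u t)
        rw [abs_sub_comm] at this
        linarith
      have h4 : (|u y| / 2) ^ 2 ≤ |u t| ^ 2 := by gcongr
      rw [div_pow, sq_abs, sq_abs] at h4
      linarith
    set P : ℝ → ℝ := fun t => v t ^ 2 / N + N * (1 - t ^ 2 / 4) * u t ^ 2 + u t ^ 2 / 2 with hP
    have hPd : ∀ t, HasDerivAt P (-(N * (t / 2) * u t ^ 2)) t := by
      intro t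
      have hu := H.hasDerivAt_fst t
      have hv := H.hasDerivAt_snd t
      refine ((((hv.pow 2).div_const N).add (((((hasDerivAt_pow 2 t).div_const 4).const_sub
        1).const_mul N).mul (hu.pow 2))).add ((hu.pow 2).div_const 2)).congr_deriv ?_
      simp only [Pi.pow_apply]
      push_cast
      field_simp
      ring
    have hy1 : 1 ≤ y := by
      rw [hNi] at hyφ
      by_contra! hc
      have h3 := pow_pos hh 3
      have h4 : y ^ 2 ≤ 1 := pow_le_one₀ hy0 hc.le
      have h5 : h ^ 2 ≤ (1 / 2) ^ 2 := by gcongr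
      linarith
    have hmono := (convex_Icc y z).image_sub_le_mul_sub_of_deriv_le (f := P)
      (fun t _ => (hPd t).continuousAt.continuousWithinAt)
      (fun t _ => (hPd t).differentiableAt.differentiableWithinAt)
      (C := -(N * (1 / 2) * (u y ^ 2 / 4)))
      (fun t ht => by
        have ht' := interior_subset ht
        rw [(hPd t).deriv]
        apply neg_le_neg
        have := hut t ht'
        have := ht'.1
        have : 1 ≤ t := by linarith
        gcongr)
      y (Set.left_mem_Icc.2 hyz) z (Set.right_mem_Icc.2 hyz) hyz
    have hPz : 0 ≤ P z := by
      have := hk z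
      simp only [hP]
      positivity
    have e1 : z - y = s * h ^ 2 := by rw [hz]; ring
    have e2 : N * (1 / 2) * (u y ^ 2 / 4) * (s * h ^ 2) = s * u y ^ 2 / (8 * h) := by
      rw [hNe]; field_simp; ring
    rw [e1, neg_mul, e2] at hmono
    have e3 : P y = v y ^ 2 / N + N * (1 - y ^ 2 / 4) * u y ^ 2 + u y ^ 2 / 2 := rfl
    have e4 : u y ^ 2 / 2 ≤ s * u y ^ 2 / (16 * h) := by
      rw [div_le_div_iff₀ (by norm_num) (by positivity)]
      have := mul_le_mul_of_nonneg_left hhs (sq_nonneg (u y))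
      linarith
    have e5 : s * u y ^ 2 / (8 * h) = 2 * (s * u y ^ 2 / (16 * h)) := by field_simp; ring
    have e6 : s * η * c / 16 / h ^ 2 ≤ s * u y ^ 2 / (16 * h) := by
      calc s * η * c / 16 / h ^ 2 ≤ s * η * (h * E) / 16 / h ^ 2 := by gcongr; exact hEy.1
        _ = s * (η * E) / (16 * h) := by field_simp
        _ ≤ _ := by gcongr
    linarith

set_option maxHeartbeats 400000 in
/-- Uniform bounds, in the oscillatory region and up to the turning point, for a solution of the
Hermite equation, its derivative and the diagonal expression. -/
theorem IsHermiteSolution.exists_bounds_of_nonneg (L : ℝ) (hL : 1 ≤ L) :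
    ∃ h₀ c C : ℝ, 0 < h₀ ∧ 0 < c ∧ 0 < C ∧ ∀ (N h : ℝ) (u v : ℝ → ℝ), IsHermiteSolution N u v →
      (∀ x, 0 ≤ v x ^ 2 / N + N * (1 - x ^ 2 / 4) * u x ^ 2) → 0 < h →
      h ^ 3 * N = 1 → h ≤ h₀ → ∀ x, 0 ≤ x → x ≤ 2 + L * h ^ 2 →
      ∀ a, 0 < a → a ^ 2 = |4 - x ^ 2| + h ^ 2 →
      u x ^ 2 ≤ C / a ∧ v x ^ 2 ≤ C * N ^ 2 * a ∧
      c * N * a ≤ v x ^ 2 / N + N * (1 - x ^ 2 / 4) * u x ^ 2 := by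
  obtain ⟨c1, C1, hc1, hC1, hE⟩ := exists_edge_energy_bounds L hL
  obtain ⟨h2, c2, hh2, hc2, hK⟩ := exists_edge_diag_lower L hL
  set Q : ℝ := 4 * (L + L ^ 2) + 7 with hQ
  have hQ1 : 1 ≤ Q := by rw [hQ]; nlinarith
  refine ⟨min h2 (1 / 2400), min (c2 / Q) (1 / 360), C1 * Q + 120, by positivity, by positivity,
    by positivity, ?_⟩
  intro N h u v H hk hh hN hh0 x hx0 hxL a ha hax
  have hhs : h ≤ 1 / 2400 := hh0.trans (min_le_right _ _)
  have hNe : N = 1 / h ^ 3 := by field_simp; linarith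
  have hN0 : 0 < N := by rw [hNe]; positivity
  have hNi : 1 / (2 * N) = h ^ 3 / 2 := by rw [hNe]; field_simp
  have hh3 : h ^ 3 ≤ h ^ 2 / 2 := by nlinarith [sq_nonneg h]
  have hh30 : 0 < h ^ 3 := by positivity
  rcases le_total (1 + 1 / (2 * N) - x ^ 2 / 4) (h ^ 2) with hcase | hcase
  · have hEx := (hE N h u v H hh hN (by linarith) x hx0 hcase hxL).2
    have hKx := hK N h u v H hk hh hN (hh0.trans (min_le_left _ _)) x hx0 hcase hxL
    rw [hNi] at hcase
    have hha : h ≤ a := by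
      apply le_of_sq_le_sq _ ha.le
      rw [hax]; linarith [abs_nonneg (4 - x ^ 2)]
    have haQ : a ≤ Q * h := by
      apply le_of_sq_le_sq _ (by positivity)
      have hx2 : x ^ 2 ≤ (2 + L * h ^ 2) ^ 2 := by gcongr
      have h4 : L ^ 2 * (h ^ 2 * h ^ 2) ≤ L ^ 2 * (h ^ 2 * 1) := by gcongr; nlinarith
      have hab : |4 - x ^ 2| ≤ (4 * (L + L ^ 2) + 6) * h ^ 2 := by
        have : 0 ≤ L * h ^ 2 := by positivity
        have : 0 ≤ L ^ 2 * h ^ 2 := by positivity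
        rw [abs_le]; constructor <;> nlinarith
      calc a ^ 2 ≤ Q * h ^ 2 := by rw [hax, hQ]; linarith
        _ ≤ Q * (Q * h ^ 2) := by
          gcongr; exact le_mul_of_one_le_left (sq_nonneg h) hQ1
        _ = (Q * h) ^ 2 := by ring
    have hu : h * u x ^ 2 ≤ C1 :=
      le_trans (by gcongr; exact le_add_of_nonneg_right (by positivity)) hEx
    have hv : h * (h ^ 4 * v x ^ 2) ≤ C1 :=
      le_trans (by gcongr; exact le_add_of_nonneg_left (by positivity)) hEx
    refine ⟨?_, ?_, ?_⟩
    · rw [le_div_iff₀ ha]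
      calc u x ^ 2 * a ≤ u x ^ 2 * (Q * h) := by gcongr
        _ = h * u x ^ 2 * Q := by ring
        _ ≤ C1 * Q := by gcongr
        _ ≤ C1 * Q + 120 := by linarith
    · calc v x ^ 2 = h * (h ^ 4 * v x ^ 2) * N ^ 2 * h := by rw [hNe]; field_simp
        _ ≤ (C1 * Q + 120) * N ^ 2 * a := by
          gcongr
          exact hv.trans (by nlinarith)
    · refine le_trans ?_ hKx
      calc min (c2 / Q) (1 / 360) * N * a ≤ c2 / Q * N * (Q * h) := by
            gcongr; exact min_le_left _ _
        _ = c2 / h ^ 2 := by rw [hNe]; field_simp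
  · set r : ℝ := Real.sqrt (1 + 1 / (2 * N) - x ^ 2 / 4) with hr
    have hr2 : r ^ 2 = 1 + 1 / (2 * N) - x ^ 2 / 4 :=
      Real.sq_sqrt (le_trans (sq_nonneg h) hcase)
    have hhr : h ≤ r := Real.le_sqrt_of_sq_le hcase
    have hr0 : 0 < r := by linarith
    obtain ⟨hl, hu⟩ := H.liouvilleGreen hh hN (by linarith) hx0 hr0 hr2 hhr
    rw [← hr2] at hcase
    rw [hNi] at hr2
    have hax' : a ^ 2 = 4 * r ^ 2 - 2 * h ^ 3 + h ^ 2 := by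
      rw [hax, abs_of_nonneg (by linarith)]; linarith
    have har : a ≤ 3 * r := by
      apply le_of_sq_le_sq _ (by positivity)
      rw [hax', mul_pow]; linarith [sq_nonneg r]
    have hra : r ≤ a := by
      apply le_of_sq_le_sq _ ha.le
      rw [hax']; linarith [sq_nonneg r]
    have hu1 : r * u x ^ 2 ≤ 40 := le_trans (le_add_of_nonneg_right (by positivity)) hu
    have hv1 : v x ^ 2 / (N ^ 2 * r) ≤ 40 := le_trans (le_add_of_nonneg_left (by positivity)) hu
    have hCQ : 0 ≤ C1 * Q := by positivity
    refine ⟨?_, ?_, ?_⟩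
    · rw [le_div_iff₀ ha]
      calc u x ^ 2 * a ≤ u x ^ 2 * (3 * r) := by gcongr
        _ ≤ C1 * Q + 120 := by linarith
    · rw [div_le_iff₀ (by positivity)] at hv1
      calc v x ^ 2 ≤ 40 * (N ^ 2 * r) := hv1
        _ ≤ (C1 * Q + 120) * (N ^ 2 * a) := by gcongr; linarith
        _ = _ := by ring
    · have e1 : v x ^ 2 / N + N * (1 - x ^ 2 / 4) * u x ^ 2 =
          N * r * (r * u x ^ 2 + v x ^ 2 / (N ^ 2 * r)) - u x ^ 2 / 2 := by
        have : 1 - x ^ 2 / 4 = r ^ 2 - h ^ 3 / 2 := by rw [hr2]; ring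
        rw [this, hNe]; field_simp; ring
      have e2 : N * r / 60 ≤ N * r * (r * u x ^ 2 + v x ^ 2 / (N ^ 2 * r)) := by
        rw [div_eq_mul_one_div]; gcongr
      have e3 : u x ^ 2 / 2 ≤ N * r * (20 * h) := by
        have : N * r * (20 * h) = 20 * r / h ^ 2 := by rw [hNe]; field_simp
        rw [this, le_div_iff₀ (by positivity)]
        have : u x ^ 2 / 2 * h ^ 2 ≤ u x ^ 2 / 2 * r ^ 2 := by gcongr
        nlinarith
      have e4 : N * r * (20 * h) ≤ N * r * (1 / 120) := by gcongr; linarith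
      calc min (c2 / Q) (1 / 360) * N * a ≤ 1 / 360 * N * (3 * r) := by
            gcongr; exact min_le_right _ _
        _ ≤ _ := by rw [e1]; linarith

theorem IsHermiteSolution.exists_bounds (L : ℝ) (hL : 1 ≤ L) :
    ∃ h₀ c C : ℝ, 0 < h₀ ∧ 0 < c ∧ 0 < C ∧ ∀ (N h : ℝ) (u v : ℝ → ℝ), IsHermiteSolution N u v →
      (∀ x, 0 ≤ v x ^ 2 / N + N * (1 - x ^ 2 / 4) * u x ^ 2) → 0 < h →
      h ^ 3 * N = 1 → h ≤ h₀ → ∀ x, |x| ≤ 2 + L * h ^ 2 →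
      ∀ a, 0 < a → a ^ 2 = |4 - x ^ 2| + h ^ 2 →
      u x ^ 2 ≤ C / a ∧ v x ^ 2 ≤ C * N ^ 2 * a ∧
      c * N * a ≤ v x ^ 2 / N + N * (1 - x ^ 2 / 4) * u x ^ 2 ∧
      v x ^ 2 / N + N * (1 - x ^ 2 / 4) * u x ^ 2 ≤ C * N * a := by
  obtain ⟨h₀, c, C, hh₀, hc, hC, hb⟩ := exists_bounds_of_nonneg L hL
  refine ⟨h₀, c, 2 * C, hh₀, hc, by positivity, ?_⟩
  intro N h u v H hk hh hN hh0 x hxL a ha hax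
  have hN0 : 0 < N := (pos_iff_pos_of_mul_pos (by rw [hN]; norm_num : 0 < h ^ 3 * N)).1
    (by positivity)
  have key : u x ^ 2 ≤ C / a ∧ v x ^ 2 ≤ C * N ^ 2 * a ∧
      c * N * a ≤ v x ^ 2 / N + N * (1 - x ^ 2 / 4) * u x ^ 2 := by
    rcases le_total 0 x with hx | hx
    · exact hb N h u v H hk hh hN hh0 x hx (le_trans (le_abs_self x) hxL) a ha hax
    · have := hb N h _ _ H.reflect (fun x => by simpa using hk (-x)) hh hN hh0 (-x)
        (by linarith) (le_trans (neg_le_abs x) hxL) a ha (by simpa using hax)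
      simpa using this
  obtain ⟨h1, h2, h3⟩ := key
  refine ⟨h1.trans (by gcongr; linarith), h2.trans (by gcongr; linarith), h3, ?_⟩
  have ha4 : 1 - x ^ 2 / 4 ≤ a ^ 2 := by
    rw [hax]
    nlinarith [le_abs_self (4 - x ^ 2), abs_nonneg (4 - x ^ 2), sq_nonneg h]
  calc v x ^ 2 / N + N * (1 - x ^ 2 / 4) * u x ^ 2
      ≤ C * N ^ 2 * a / N + N * a ^ 2 * (C / a) := by gcongr
    _ = 2 * C * N * a := by field_simp; ring

theorem pow_three_mul_le_of_le {A t q α β τ : ℝ} (hA : 0 ≤ A) (ht0 : 0 ≤ t) (ht1 : t ≤ 1)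
    (htτ : t * τ ≤ 5) (hq : 0 ≤ q) (hα : 1 ≤ α) (hβ : 1 ≤ β) (hτ : 0 ≤ τ)
    (hq1 : q ≤ A * (α * β))
    (hq2 : τ ^ 2 * q ≤ A * (β / α + α / β + t * τ * τ / (α * β)))
    (hαβ : |α ^ 2 - β ^ 2| ≤ 5 * τ) :
    q ^ 3 * α * (1 + (β * τ) ^ 2) ≤ 10 ^ 6 * A ^ 3 * β ^ 7 := by
  have hα0 : 0 < α := by linarith
  have hβ0 : 0 < β := by linarith
  obtain ⟨hl, hu⟩ := abs_le.1 hαβ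
  have hβ2 : 1 ≤ β ^ 2 := one_le_pow₀ hβ
  have hα2 : 1 ≤ α ^ 2 := one_le_pow₀ hα
  rcases le_total (β * τ) 1 with h1 | h1
  · have hτ1 : τ ≤ 1 := le_trans (le_mul_of_one_le_left hτ hβ) h1
    have hα6 : α ^ 2 ≤ 6 * β ^ 2 := by linarith
    have h2 : (β * τ) ^ 2 ≤ 1 := pow_le_one₀ (by positivity) h1
    calc q ^ 3 * α * (1 + (β * τ) ^ 2) ≤ (A * (α * β)) ^ 3 * α * (1 + 1) := by gcongr
      _ = 2 * A ^ 3 * β ^ 3 * (α ^ 2) ^ 2 := by ring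
      _ ≤ 2 * A ^ 3 * β ^ 3 * (6 * β ^ 2) ^ 2 := by gcongr
      _ = 72 * A ^ 3 * β ^ 7 := by ring
      _ ≤ 10 ^ 6 * A ^ 3 * β ^ 7 := by gcongr; norm_num
  · have hτ0 : 0 < τ := by
      rcases hτ.eq_or_lt with h | h
      · rw [← h] at h1; norm_num at h1
      · exact h
    have hb2 : 1 ≤ (β * τ) ^ 2 := one_le_pow₀ h1
    have hb4 : 1 ≤ (β * τ) ^ 4 := one_le_pow₀ h1
    have k1 : 1 ≤ 10 ^ 4 * (α ^ 2 * β ^ 2 * τ ^ 4) := by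
      rcases le_total τ (β ^ 2 / 10) with h | h
      · calc (1 : ℝ) ≤ 10 ^ 4 * (1 / 2 * (β * τ) ^ 4) := by linarith
          _ = 10 ^ 4 * (β ^ 2 / 2 * β ^ 2 * τ ^ 4) := by ring
          _ ≤ _ := by gcongr; linarith
      · calc (1 : ℝ) = 10 ^ 4 * (1 * 1 * (1 / 10) ^ 4) := by norm_num
          _ ≤ _ := by gcongr; linarith
    have k2 : α ^ 4 ≤ 52 * (β ^ 8 * τ ^ 4) := by
      have e1 : β ^ 4 ≤ β ^ 8 * τ ^ 4 := by
        calc β ^ 4 = β ^ 4 * 1 := by ring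
          _ ≤ β ^ 4 * (β * τ) ^ 4 := by gcongr
          _ = _ := by ring
      have e2 : τ ^ 2 ≤ β ^ 8 * τ ^ 4 := by
        calc τ ^ 2 = 1 * (τ ^ 2 * 1) := by ring
          _ ≤ (β ^ 2) ^ 3 * (τ ^ 2 * (β * τ) ^ 2) := by
            gcongr; exact one_le_pow₀ hβ2
          _ = _ := by ring
      calc α ^ 4 = (α ^ 2) ^ 2 := by ring
        _ ≤ (β ^ 2 + 5 * τ) ^ 2 := by gcongr; linarith
        _ ≤ 2 * β ^ 4 + 50 * τ ^ 2 := by linarith [sq_nonneg (β ^ 2 - 5 * τ)]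
        _ ≤ _ := by linarith
    have k3 : t ^ 3 * τ ^ 2 ≤ 25 * (α ^ 2 * β ^ 8) := by
      calc t ^ 3 * τ ^ 2 = t * (t * τ) ^ 2 := by ring
        _ ≤ 1 * 5 ^ 2 := by gcongr
        _ = 25 * (1 * 1) := by norm_num
        _ ≤ _ := by gcongr; exact one_le_pow₀ hβ
    have m1 : (β / α) ^ 3 * α ≤ 10 ^ 4 * (β ^ 5 * τ ^ 4) := by
      have : (β / α) ^ 3 * α = β ^ 3 / α ^ 2 * 1 := by field_simp
      rw [this]
      calc β ^ 3 / α ^ 2 * 1 ≤ β ^ 3 / α ^ 2 * (10 ^ 4 * (α ^ 2 * β ^ 2 * τ ^ 4)) := by gcongr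
        _ = _ := by field_simp
    have m2 : (α / β) ^ 3 * α ≤ 52 * (β ^ 5 * τ ^ 4) := by
      have : (α / β) ^ 3 * α = α ^ 4 / β ^ 3 := by field_simp
      rw [this]
      calc α ^ 4 / β ^ 3 ≤ 52 * (β ^ 8 * τ ^ 4) / β ^ 3 := by gcongr
        _ = _ := by field_simp
    have m3 : (t * τ * τ / (α * β)) ^ 3 * α ≤ 25 * (β ^ 5 * τ ^ 4) := by
      have : (t * τ * τ / (α * β)) ^ 3 * α = t ^ 3 * τ ^ 2 * τ ^ 4 / (α ^ 2 * β ^ 3) := by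
        field_simp
      rw [this]
      calc t ^ 3 * τ ^ 2 * τ ^ 4 / (α ^ 2 * β ^ 3)
          ≤ 25 * (α ^ 2 * β ^ 8) * τ ^ 4 / (α ^ 2 * β ^ 3) := by gcongr
        _ = _ := by field_simp
    have cube : ∀ a b c : ℝ, 0 ≤ a → 0 ≤ b → 0 ≤ c →
        (a + b + c) ^ 3 ≤ 9 * (a ^ 3 + b ^ 3 + c ^ 3) := by
      intro a b c ha hb hc
      nlinarith [mul_nonneg (add_nonneg ha hb) (sq_nonneg (a - b)),
        mul_nonneg (add_nonneg ha hc) (sq_nonneg (a - c)),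
        mul_nonneg (add_nonneg hb hc) (sq_nonneg (b - c)), mul_nonneg ha (sq_nonneg (b - c)),
        mul_nonneg hb (sq_nonneg (a - c)), mul_nonneg hc (sq_nonneg (a - b))]
    have main : q ^ 3 * α * τ ^ 2 * τ ^ 4 ≤ 10 ^ 5 * A ^ 3 * β ^ 5 * τ ^ 4 := by
      calc q ^ 3 * α * τ ^ 2 * τ ^ 4 = (τ ^ 2 * q) ^ 3 * α := by ring
        _ ≤ (A * (β / α + α / β + t * τ * τ / (α * β))) ^ 3 * α := by gcongr
        _ = A ^ 3 * (β / α + α / β + t * τ * τ / (α * β)) ^ 3 * α := by rw [mul_pow]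
        _ ≤ A ^ 3 * (9 * ((β / α) ^ 3 + (α / β) ^ 3 + (t * τ * τ / (α * β)) ^ 3)) * α := by
          gcongr
          exact cube _ _ _ (by positivity) (by positivity) (by positivity)
        _ = A ^ 3 * (9 * ((β / α) ^ 3 * α + (α / β) ^ 3 * α +
            (t * τ * τ / (α * β)) ^ 3 * α)) := by ring
        _ ≤ A ^ 3 * (10 ^ 5 * (β ^ 5 * τ ^ 4)) := by
          refine mul_le_mul_of_nonneg_left ?_ (by positivity)
          have : 0 ≤ β ^ 5 * τ ^ 4 := by positivity
          linarith
        _ = _ := by ring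
    have main' := le_of_mul_le_mul_right main (by positivity)
    calc q ^ 3 * α * (1 + (β * τ) ^ 2) ≤ q ^ 3 * α * ((β * τ) ^ 2 + (β * τ) ^ 2) := by gcongr
      _ = 2 * β ^ 2 * (q ^ 3 * α * τ ^ 2) := by ring
      _ ≤ 2 * β ^ 2 * (10 ^ 5 * A ^ 3 * β ^ 5) := by gcongr
      _ = 2 * 10 ^ 5 * A ^ 3 * β ^ 7 := by ring
      _ ≤ 10 ^ 6 * A ^ 3 * β ^ 7 := by gcongr; norm_num

theorem continuous_Kker (n : ℕ) (y : ℝ) : Continuous fun x => Kker n x y := by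
  simp only [Kker, hermiteFun]
  fun_prop

theorem continuous_Kker_self (n : ℕ) : Continuous fun x => Kker n x x := by
  simp only [Kker, hermiteFun]
  fun_prop

theorem Kker_sq_le (n : ℕ) (x y : ℝ) : Kker n x y ^ 2 ≤ Kker n x x * Kker n y y := by
  have := Finset.sum_mul_sq_le_sq_mul_sq (Finset.range n) (fun k => hermiteFun n k x)
    (fun k => hermiteFun n k y)
  simpa only [Kker, sq (hermiteFun _ _ _)] using this

theorem Kker_self_nonneg (n : ℕ) (x : ℝ) : 0 ≤ Kker n x x :=
  Finset.sum_nonneg fun _ _ => mul_self_nonneg _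

theorem Kker_self_pos {n : ℕ} (hn : 1 ≤ n) (x : ℝ) : 0 < Kker n x x := by
  have h0 : 0 < hermiteFun n 0 x := by
    have : (0 : ℝ) < n := by exact_mod_cast hn
    simp only [hermiteFun, Polynomial.hermite_zero]
    simp
    positivity
  calc 0 < hermiteFun n 0 x * hermiteFun n 0 x := by positivity
    _ ≤ Kker n x x := Finset.single_le_sum
      (f := fun k => hermiteFun n k x * hermiteFun n k x)
      (fun _ _ => mul_self_nonneg _) (Finset.mem_range.2 hn)

/-- The off-diagonal estimate for a single `n`, on a bounded set of `y`. -/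
theorem exists_integral_Kker_le {n : ℕ} (hn : 1 ≤ n) (R : ℝ) :
    ∃ C : ℝ, 0 < C ∧ ∀ y : ℝ, |y| ≤ R →
      (∫ x in (-2 : ℝ)..2, Kker n x y ^ 6 * Kker n x x) ≤ C * Kker n y y ^ 6 := by
  rcases lt_or_ge R 0 with hR | hR
  · exact ⟨1, one_pos, fun y hy => absurd (abs_nonneg y) (by linarith)⟩
  have hk := continuous_Kker_self n
  obtain ⟨z, -, hz⟩ := (isCompact_Icc (a := -R) (b := R)).exists_isMinOn
    ⟨0, by constructor <;> linarith⟩ hk.continuousOn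
  have hm : 0 < Kker n z z := Kker_self_pos hn z
  have hI : 0 ≤ ∫ x in (-2 : ℝ)..2, Kker n x x ^ 4 :=
    intervalIntegral.integral_nonneg (by norm_num) fun x _ => by positivity
  refine ⟨(∫ x in (-2 : ℝ)..2, Kker n x x ^ 4) / Kker n z z ^ 3 + 1, by positivity, ?_⟩
  intro y hy
  have hzy : Kker n z z ≤ Kker n y y := hz (abs_le.1 hy)
  have hy0 : 0 < Kker n y y := Kker_self_pos hn y
  calc (∫ x in (-2 : ℝ)..2, Kker n x y ^ 6 * Kker n x x)
      ≤ ∫ x in (-2 : ℝ)..2, Kker n x x ^ 4 * Kker n y y ^ 3 := by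
        refine intervalIntegral.integral_mono_on (by norm_num)
          ((((continuous_Kker n y).pow 6).mul hk).intervalIntegrable _ _)
          (((hk.pow 4).mul continuous_const).intervalIntegrable _ _) fun x _ => ?_
        have := Kker_self_nonneg n x
        calc Kker n x y ^ 6 * Kker n x x = (Kker n x y ^ 2) ^ 3 * Kker n x x := by ring
          _ ≤ (Kker n x x * Kker n y y) ^ 3 * Kker n x x := by
            gcongr; exact Kker_sq_le n x y
          _ = _ := by ring
    _ = (∫ x in (-2 : ℝ)..2, Kker n x x ^ 4) / Kker n z z ^ 3 *
        (Kker n z z ^ 3 * Kker n y y ^ 3) := by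
      rw [intervalIntegral.integral_mul_const]; field_simp
    _ ≤ ((∫ x in (-2 : ℝ)..2, Kker n x x ^ 4) / Kker n z z ^ 3 + 1) *
        (Kker n y y ^ 3 * Kker n y y ^ 3) := by
      gcongr; linarith
    _ = _ := by ring

theorem integral_inv_one_add_sq_le {c : ℝ} (hc : 0 < c) (y a b : ℝ) :
    ∫ x in a..b, 1 / (1 + (c * (x - y)) ^ 2) ≤ Real.pi / c := by
  have hd : ∀ x, HasDerivAt (fun x => Real.arctan (c * (x - y)) / c)
      (1 / (1 + (c * (x - y)) ^ 2)) x := fun x =>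
    ((((hasDerivAt_id x).sub_const y).const_mul c).arctan.div_const c).congr_deriv (by
      simp only [id]; field_simp)
  rw [intervalIntegral.integral_eq_sub_of_hasDerivAt (fun x _ => hd x)
    (Continuous.intervalIntegrable (continuous_const.div (by fun_prop) fun x => by positivity) _ _),
    ← sub_div]
  gcongr
  linarith [Real.arctan_lt_pi_div_two (c * (b - y)), Real.neg_pi_div_two_lt_arctan (c * (a - y))]

/-- Pointwise decay away from the diagonal, from the Christoffel–Darboux formula and the uniform
bounds on the Hermite functions. -/
theorem pow_six_mul_le_of_christoffelDarboux {C N h K k l u v p q x y a b : ℝ} (hC : 0 < C)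
    (hh : 0 < h) (hh1 : h ≤ 1) (hN : h ^ 3 * N = 1) (ha : 0 < a) (hb : 0 < b)
    (hax : a ^ 2 = |4 - x ^ 2| + h ^ 2) (hby : b ^ 2 = |4 - y ^ 2| + h ^ 2)
    (hx : |x| ≤ 2) (hy : |y| ≤ 3) (hu : u ^ 2 ≤ C / a) (hv : v ^ 2 ≤ C * N ^ 2 * a)
    (hp : p ^ 2 ≤ C / b) (hq : q ^ 2 ≤ C * N ^ 2 * b) (hk : k ≤ C * N * a)
    (hl0 : 0 ≤ l) (hl : l ≤ C * N * b) (hK : K ^ 2 ≤ k * l)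
    (hcd : (x - y) * K = (u * q - v * p) / N - (x - y) / 2 * (u * p)) :
    K ^ 6 * k ≤ 10 ^ 6 * (3 * C ^ 2) ^ 3 * C * (N * b) ^ 7 *
      (1 / (1 + (N * b * (x - y)) ^ 2)) := by
  have hNe : N = 1 / h ^ 3 := by field_simp; linarith
  have hN0 : 0 < N := by rw [hNe]; positivity
  have hxy : |x - y| ≤ 5 := (abs_sub x y).trans (by linarith)
  have hle : ∀ c z : ℝ, 0 < c → c ^ 2 = |4 - z ^ 2| + h ^ 2 → 1 ≤ c / h := by
    intro c z hc hcz
    rw [one_le_div hh]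
    apply le_of_sq_le_sq _ hc.le
    rw [hcz]; linarith [abs_nonneg (4 - z ^ 2)]
  have hab : |(a / h) ^ 2 - (b / h) ^ 2| ≤ 5 * (|x - y| / h ^ 2) := by
    have e1 : (a / h) ^ 2 - (b / h) ^ 2 = (|4 - x ^ 2| - |4 - y ^ 2|) / h ^ 2 := by
      rw [div_pow, div_pow, hax, hby]; ring
    rw [e1, abs_div, abs_of_pos (by positivity : 0 < h ^ 2), ← mul_div_assoc]
    gcongr
    calc |(|4 - x ^ 2| - |4 - y ^ 2|)| ≤ |4 - x ^ 2 - (4 - y ^ 2)| :=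
          abs_abs_sub_abs_le_abs_sub _ _
      _ = |x + y| * |x - y| := by rw [← abs_mul, ← abs_neg]; ring_nf
      _ ≤ 5 * |x - y| := by gcongr; exact (abs_add_le x y).trans (by linarith)
  have hq1 : K ^ 2 * h ^ 4 ≤ 3 * C ^ 2 * (a / h * (b / h)) := by
    calc K ^ 2 * h ^ 4 ≤ C * N * a * (C * N * b) * h ^ 4 := by
          gcongr; exact hK.trans (by gcongr)
      _ = C ^ 2 * (a / h * (b / h)) := by rw [hNe]; field_simp
      _ ≤ _ := by gcongr; linarith [sq_nonneg C]
  have hq2 : (|x - y| / h ^ 2) ^ 2 * (K ^ 2 * h ^ 4) ≤ 3 * C ^ 2 * (b / h / (a / h) +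
      a / h / (b / h) + h ^ 2 * (|x - y| / h ^ 2) * (|x - y| / h ^ 2) / (a / h * (b / h))) := by
    have three : ∀ r s w : ℝ, (r - s - w) ^ 2 ≤ 3 * (r ^ 2 + s ^ 2 + w ^ 2) := fun r s w => by
      linarith [sq_nonneg (r + s), sq_nonneg (r + w), sq_nonneg (s - w)]
    have e1 : (|x - y| / h ^ 2) ^ 2 * (K ^ 2 * h ^ 4) = ((x - y) * K) ^ 2 := by
      rw [div_pow, sq_abs]; field_simp
    have e2 : h ^ 2 * (|x - y| / h ^ 2) * (|x - y| / h ^ 2) / (a / h * (b / h)) =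
        (x - y) ^ 2 / (a * b) := by
      rw [← sq_abs (x - y)]; field_simp
    rw [e1, e2, hcd, sub_div]
    calc (u * q / N - v * p / N - (x - y) / 2 * (u * p)) ^ 2
        ≤ 3 * ((u * q / N) ^ 2 + (v * p / N) ^ 2 + ((x - y) / 2 * (u * p)) ^ 2) := three _ _ _
      _ = 3 * (u ^ 2 * q ^ 2 / N ^ 2 + v ^ 2 * p ^ 2 / N ^ 2 +
          (x - y) ^ 2 / 4 * (u ^ 2 * p ^ 2)) := by ring
      _ ≤ 3 * (C / a * (C * N ^ 2 * b) / N ^ 2 + C * N ^ 2 * a * (C / b) / N ^ 2 +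
          (x - y) ^ 2 / 1 * (C / a * (C / b))) := by gcongr; norm_num
      _ = _ := by field_simp
  have key := pow_three_mul_le_of_le (by positivity) (sq_nonneg h) (pow_le_one₀ hh.le hh1)
    (by rw [mul_div_cancel₀ _ (by positivity)]; exact hxy) (by positivity) (hle a x ha hax)
    (hle b y hb hby) (by positivity) hq1 hq2 hab
  have e3 : b / h * (|x - y| / h ^ 2) = N * b * |x - y| := by rw [hNe]; field_simp
  rw [e3, mul_pow _ |x - y|, sq_abs, ← mul_pow] at key
  rw [mul_one_div, le_div_iff₀ (by positivity)]
  calc K ^ 6 * k * (1 + (N * b * (x - y)) ^ 2)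
      ≤ K ^ 6 * (C * N * a) * (1 + (N * b * (x - y)) ^ 2) := by gcongr
    _ = C / h ^ 14 * ((K ^ 2 * h ^ 4) ^ 3 * (a / h) * (1 + (N * b * (x - y)) ^ 2)) := by
      rw [hNe]; field_simp
    _ ≤ C / h ^ 14 * (10 ^ 6 * (3 * C ^ 2) ^ 3 * (b / h) ^ 7) := by gcongr
    _ = _ := by rw [hNe]; field_simp

/-- The off-diagonal estimate for all sufficiently large `n`, where `h = n ^ (-1/3)`. -/
theorem exists_integral_Kker_le_of_small (M : ℝ) (hM : 1 ≤ M) :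
    ∃ h₀ C : ℝ, 0 < h₀ ∧ 0 < C ∧ ∀ n : ℕ, 1 ≤ n → ∀ h : ℝ, 0 < h → h ^ 3 * n = 1 → h ≤ h₀ →
      ∀ y : ℝ, |y| ≤ 2 + M * h ^ 2 →
        (∫ x in (-2 : ℝ)..2, Kker n x y ^ 6 * Kker n x x) ≤ C * Kker n y y ^ 6 := by
  obtain ⟨h₀, c, C, hh₀, hc, hC, hb⟩ := IsHermiteSolution.exists_bounds M hM
  have hM0 : 0 < M := by linarith
  set D : ℝ := 10 ^ 6 * (3 * C ^ 2) ^ 3 * C with hD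
  have hD0 : 0 < D := by positivity
  clear_value D
  refine ⟨min h₀ (1 / M), D * Real.pi / c ^ 6, by positivity, by positivity, ?_⟩
  intro n hn h hh hN hle y hy
  have hhM : h ≤ 1 / M := hle.trans (min_le_right _ _)
  have hMh : M * h ≤ 1 := by rwa [mul_comm, ← le_div_iff₀ hM0]
  have hh1 : h ≤ 1 := (le_mul_of_one_le_left hh.le hM).trans hMh
  have hMh2 : M * h ^ 2 ≤ 1 := by
    calc M * h ^ 2 = M * h * h := by ring
      _ ≤ 1 := mul_le_one₀ hMh hh.le hh1
  have hn0 : (0 : ℝ) < n := by exact_mod_cast hn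
  obtain ⟨u, v, H, hdiag, hcd⟩ := exists_isHermiteSolution_Kker n hn
  have hroot : ∀ z : ℝ, 0 < Real.sqrt (|4 - z ^ 2| + h ^ 2) ∧
      Real.sqrt (|4 - z ^ 2| + h ^ 2) ^ 2 = |4 - z ^ 2| + h ^ 2 := fun z =>
    ⟨Real.sqrt_pos.2 (by positivity), Real.sq_sqrt (by positivity)⟩
  have hbd : ∀ z : ℝ, |z| ≤ 2 + M * h ^ 2 → ∀ a, 0 < a → a ^ 2 = |4 - z ^ 2| + h ^ 2 →
      u z ^ 2 ≤ C / a ∧ v z ^ 2 ≤ C * n ^ 2 * a ∧ c * n * a ≤ Kker n z z ∧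
      Kker n z z ≤ C * n * a := fun z hz a ha haz => by
    rw [hdiag]
    exact hb n h u v H (fun x => hdiag x ▸ Kker_self_nonneg n x) hh hN
      (hle.trans (min_le_left _ _)) z hz a ha haz
  obtain ⟨hb0, hby⟩ := hroot y
  set b : ℝ := Real.sqrt (|4 - y ^ 2| + h ^ 2)
  clear_value b
  obtain ⟨hp, hq, hlow, hl⟩ := hbd y hy b hb0 hby
  have hpt : ∀ x ∈ Set.Icc (-2 : ℝ) 2, Kker n x y ^ 6 * Kker n x x ≤
      D * (n * b) ^ 7 * (1 / (1 + (n * b * (x - y)) ^ 2)) := by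
    intro x hx
    obtain ⟨ha0, hax⟩ := hroot x
    have hx2 : |x| ≤ 2 := abs_le.2 hx
    obtain ⟨hu, hv, -, hk⟩ := hbd x (hx2.trans (by linarith [mul_pos hM0 (pow_pos hh 2)])) _ ha0 hax
    rw [hD]
    exact pow_six_mul_le_of_christoffelDarboux hC hh hh1 hN ha0 hb0 hax hby hx2
      (by linarith) hu hv hp hq hk (Kker_self_nonneg n y) hl (Kker_sq_le n x y) (hcd x y)
  have hcont : Continuous fun x => D * (n * b) ^ 7 * (1 / (1 + (n * b * (x - y)) ^ 2)) :=
    continuous_const.mul (continuous_const.div (by fun_prop) fun x => by positivity)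
  calc (∫ x in (-2 : ℝ)..2, Kker n x y ^ 6 * Kker n x x)
      ≤ ∫ x in (-2 : ℝ)..2, D * (n * b) ^ 7 * (1 / (1 + (n * b * (x - y)) ^ 2)) :=
        intervalIntegral.integral_mono_on (by norm_num)
          ((((continuous_Kker n y).pow 6).mul (continuous_Kker_self n)).intervalIntegrable _ _)
          (hcont.intervalIntegrable _ _) hpt
    _ ≤ D * (n * b) ^ 7 * (Real.pi / (n * b)) := by
      rw [intervalIntegral.integral_const_mul]
      gcongr
      exact integral_inv_one_add_sq_le (by positivity) y _ _
    _ = D * Real.pi / c ^ 6 * (c * n * b) ^ 6 := by field_simp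
    _ ≤ D * Real.pi / c ^ 6 * Kker n y y ^ 6 := by gcongr

/-- Off-diagonal kernel estimate. -/
theorem kernel_estimate_two (M : ℝ) (hM : 1 ≤ M) :
    ∃ C : ℝ, 0 < C ∧
      ∀ n : ℕ, 1 ≤ n → ∀ y : ℝ, |y| ≤ 2 + M * (n : ℝ) ^ (-(2 : ℝ) / 3) →
        (∫ x in (-2 : ℝ)..2, Kker n x y ^ 6 * Kker n x x) ≤ C * Kker n y y ^ 6 := by
  obtain ⟨h₀, C₀, hh₀, hC₀, hlarge⟩ := exists_integral_Kker_le_of_small M hM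
  have hsmall : ∀ n : ℕ, ∃ C : ℝ, 0 < C ∧ (1 ≤ n → ∀ y : ℝ,
      |y| ≤ 2 + M * (n : ℝ) ^ (-(2 : ℝ) / 3) →
        (∫ x in (-2 : ℝ)..2, Kker n x y ^ 6 * Kker n x x) ≤ C * Kker n y y ^ 6) := by
    intro n
    by_cases hn : 1 ≤ n
    · obtain ⟨C, hC, h⟩ := exists_integral_Kker_le hn (2 + M * (n : ℝ) ^ (-(2 : ℝ) / 3))
      exact ⟨C, hC, fun _ => h⟩
    · exact ⟨1, one_pos, fun h => absurd h hn⟩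
  choose C hC hCn using hsmall
  have hsum : 0 ≤ ∑ k ∈ Finset.range ⌈1 / h₀ ^ 3⌉₊, C k := Finset.sum_nonneg fun k _ => (hC k).le
  refine ⟨C₀ + ∑ k ∈ Finset.range ⌈1 / h₀ ^ 3⌉₊, C k, by positivity, ?_⟩
  intro n hn y hy
  have hk0 : 0 ≤ Kker n y y := Kker_self_nonneg n y
  rcases lt_or_ge n ⌈1 / h₀ ^ 3⌉₊ with hlt | hge
  · refine (hCn n hn y hy).trans ?_
    gcongr
    exact (Finset.single_le_sum (f := C) (fun k _ => (hC k).le) (Finset.mem_range.2 hlt)).trans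
      (by linarith)
  · have hn0 : (0 : ℝ) < n := by exact_mod_cast hn
    have hpow : ((n : ℝ) ^ (-(1 : ℝ) / 3)) ^ 3 = 1 / n := by
      rw [← Real.rpow_natCast, ← Real.rpow_mul hn0.le]
      norm_num [Real.rpow_neg_one]
    have hsq : (n : ℝ) ^ (-(2 : ℝ) / 3) = ((n : ℝ) ^ (-(1 : ℝ) / 3)) ^ 2 := by
      rw [← Real.rpow_natCast, ← Real.rpow_mul hn0.le]
      norm_num
    have hle : (n : ℝ) ^ (-(1 : ℝ) / 3) ≤ h₀ := by
      refine le_of_pow_le_pow_left₀ (n := 3) (by norm_num) hh₀.le ?_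
      rw [hpow, one_div_le hn0 (by positivity)]
      exact Nat.ceil_le.1 hge
    rw [hsq] at hy
    refine (hlarge n hn _ (by positivity) (by rw [hpow]; field_simp) hle y hy).trans ?_
    gcongr
    linarith
end
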